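/- For every d∈ℕ+ there exist a universal constant c>0 (independent of d) and 7-layer transformer parameters Θ* with token dimension 4d+8, at most 8 attention heads in each attention layer, FFN width at most c·d, at most c·d nonzero parameter entries in total, all parameter entries of absolute value at most c, such that Θ* has the emulation property. -/

import Mathlib

open scoped BigOperators
open Matrix

noncomputable section

namespace PromptTF

/-- The ReLU activation function. -/
def relu (x : ℝ) : ℝ := max x 0

/-- The elementary universal activation function (EUAF). -/
def euaf (x : ℝ) : ℝ :=
  if 0 ≤ x then |x - 2 * (⌊(x + 1) / 2⌋ : ℝ)| else x / (1 + |x|)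

/-- Parameters of one transformer layer (attention heads and a feed-forward net). -/
structure TFLayer (D : ℕ) where
  M : ℕ
  Q : Fin M → Matrix (Fin D) (Fin D) ℝ
  K : Fin M → Matrix (Fin D) (Fin D) ℝ
  V : Fin M → Matrix (Fin D) (Fin D) ℝ
  width : ℕ
  W1 : Matrix (Fin width) (Fin D) ℝ
  W2 : Matrix (Fin D) (Fin width) ℝ

/-- Self-attention layer applied to a list of tokens. -/
def attnOut {D : ℕ} (θ : TFLayer D) (H : List (Fin D → ℝ)) : List (Fin D → ℝ) :=
  H.map fun h => fun i =>
    h i + ∑ m : Fin θ.M,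
      (H.map fun h' =>
        relu (dotProduct ((θ.Q m).mulVec h) ((θ.K m).mulVec h')) * ((θ.V m).mulVec h') i).sum

/-- One transformer layer `FFN ∘ Attn`, with feed-forward activation `act`. -/
def layerMap {D : ℕ} (act : ℝ → ℝ) (θ : TFLayer D) (H : List (Fin D → ℝ)) :
    List (Fin D → ℝ) :=
  (attnOut θ H).map fun h => fun i =>
    h i + (θ.W2.mulVec fun k => act ((θ.W1.mulVec h) k)) i

/-- Multi-layer transformer, all activations ReLU. -/
def tfForward {D : ℕ} (Θ : List (TFLayer D)) (H : List (Fin D → ℝ)) : List (Fin D → ℝ) :=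
  Θ.foldl (fun H' θ => layerMap relu θ H') H

/-- Multi-layer transformer whose first feed-forward layer uses the EUAF activation. -/
def tfForwardEUAF {D : ℕ} (Θ : List (TFLayer D)) (H : List (Fin D → ℝ)) :
    List (Fin D → ℝ) :=
  match Θ with
  | [] => H
  | θ :: rest => rest.foldl (fun H' θ' => layerMap relu θ' H') (layerMap euaf θ H)

/-- Sequential (autoregressive) generation: append the last output column repeatedly. -/
def genTokens {D : ℕ} (forward : List (Fin D → ℝ) → List (Fin D → ℝ))
    (H : List (Fin D → ℝ)) : ℕ → List (Fin D → ℝ)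
  | 0 => H
  | v + 1 =>
      genTokens forward H v ++ [(forward (genTokens forward H v)).getLastD (fun _ => 0)]

/-- The token at one-based position `m` in the generated sequence. -/
def tokenAt {D : ℕ} (forward : List (Fin D → ℝ) → List (Fin D → ℝ))
    (H : List (Fin D → ℝ)) (m : ℕ) : Fin D → ℝ :=
  (genTokens forward H (m - H.length)).getD (m - 1) (fun _ => 0)

/-- A token with word embedding `u`, layer index `w`, position `j` and scale `S`:
`(uᵀ, 0_{3d+4}ᵀ, 1, S, S·w, S·j)ᵀ ∈ ℝ^{4d+8}`. -/
def promptToken (d : ℕ) (u : Fin d → ℝ) (w : ℤ) (j : ℕ) (S : ℝ) : Fin (4 * d + 8) → ℝ :=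
  fun i =>
    if h : (i : ℕ) < d then u ⟨i, h⟩
    else if (i : ℕ) = 4 * d + 4 then 1
    else if (i : ℕ) = 4 * d + 5 then S
    else if (i : ℕ) = 4 * d + 6 then S * w
    else if (i : ℕ) = 4 * d + 7 then S * j
    else 0

/-- First `d` coordinates of a token. -/
def firstd (d : ℕ) (h : Fin (4 * d + 8) → ℝ) : Fin d → ℝ :=
  fun k => h (Fin.castLE (by omega) k)

/-- Initial input: `T` prompt tokens followed by `N` data tokens. -/
def initialInput (d T N : ℕ) (u : Fin T → Fin d → ℝ) (w : Fin T → ℕ) (S : ℝ)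
    (z : Fin N → Fin d → ℝ) : List (Fin (4 * d + 8) → ℝ) :=
  ((List.finRange T).map fun j => promptToken d (u j) (w j) ((j : ℕ) + 1) S)
    ++ ((List.finRange N).map fun i => promptToken d (z i) 0 (T + (i : ℕ) + 1) S)

/-- The closed Euclidean ball of radius `B` in `ℝ^d`. -/
def eball (d : ℕ) (B : ℝ) : Set (Fin d → ℝ) :=
  {v | Real.sqrt (∑ k, v k ^ 2) ≤ B}

/-- Data of a valid prompt in `P_U(T, L, S)`: word embeddings in `U`,
layer indices in `{1, …, 2L}`. -/
def ValidPrompt {d : ℕ} (U : Set (Fin d → ℝ)) (T L : ℕ)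
    (u : Fin T → Fin d → ℝ) (w : Fin T → ℕ) : Prop :=
  (∀ j, u j ∈ U) ∧ ∀ j, 1 ≤ w j ∧ w j ≤ 2 * L

/-- The virtual weight matrix `W^P_ℓ` (without the first-layer correction term). -/
def WPmat {d T : ℕ} (u : Fin T → Fin d → ℝ) (w : Fin T → ℕ) (ℓ : ℕ) :
    Matrix (Fin d) (Fin d) ℝ :=
  ∑ j : Fin T,
    if h : (j : ℕ) + 1 < T then
      (if w j = 2 * ℓ - 1 ∧ w ⟨(j : ℕ) + 1, h⟩ = 2 * ℓ then
        vecMulVec (u j) (u ⟨(j : ℕ) + 1, h⟩) else 0)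
    else 0

/-- The first-layer correction term `(h_T)_{1:d} 1{w_T=1} Σ_{j'} (h_{j'})_{1:d}ᵀ 1{w_{j'}=1}`. -/
def WPcorr {d T : ℕ} (u : Fin T → Fin d → ℝ) (w : Fin T → ℕ) :
    Matrix (Fin d) (Fin d) ℝ :=
  if hT : 0 < T then
    (if w ⟨T - 1, by omega⟩ = 1 then
      vecMulVec (u ⟨T - 1, by omega⟩) (∑ j : Fin T, if w j = 1 then u j else 0)
    else 0)
  else 0

/-- The virtual first-layer weight matrix `W^P_{1,i}`; `first` indicates `i = 1`. -/
def WPone {d T : ℕ} (u : Fin T → Fin d → ℝ) (w : Fin T → ℕ) (first : Bool) :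
    Matrix (Fin d) (Fin d) ℝ :=
  WPmat u w 1 + if first then WPcorr u w else 0

/-- The family of virtual weight matrices of a prompt, for the data token with
zero-based index `i`. -/
def WPfam {d T : ℕ} (u : Fin T → Fin d → ℝ) (w : Fin T → ℕ) (i : ℕ) :
    ℕ → Matrix (Fin d) (Fin d) ℝ :=
  fun ℓ => if ℓ = 1 then WPone u w (i == 0) else WPmat u w ℓ

/-- Output of the virtual network after `ℓ` layers:
`vnetOut … ℓ = W_ℓ act(W_{ℓ-1} act( ⋯ act(W_1 z) ⋯ ))`. -/
def vnetOut (d : ℕ) (act : ℝ → ℝ) (Ws : ℕ → Matrix (Fin d) (Fin d) ℝ)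
    (z : Fin d → ℝ) : ℕ → Fin d → ℝ
  | 0 => z
  | ℓ + 1 =>
      (Ws (ℓ + 1)).mulVec fun k =>
        if ℓ = 0 then vnetOut d act Ws z ℓ k else act (vnetOut d act Ws z ℓ k)

/-- The emulation property: for every admissible prompt and data tokens, the sequentially
generated tokens realize the virtual neural network encoded by the prompt
(with activation `act`). -/
def EmulatesWith (d : ℕ)
    (forward : List (Fin (4 * d + 8) → ℝ) → List (Fin (4 * d + 8) → ℝ))
    (act : ℝ → ℝ) : Prop :=
  ∀ B : ℝ, 1 ≤ B → ∀ T L : ℕ, 0 < T → 0 < L →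
  ∀ U : Set (Fin d → ℝ), U ⊆ eball d B →
  ∀ S : ℝ, max ((d : ℝ) * B ^ (4 * L) * (T : ℝ) ^ (2 * L)) (2 * (L : ℝ)) ≤ S →
  ∀ (u : Fin T → Fin d → ℝ) (w : Fin T → ℕ), ValidPrompt U T L u w →
  ∀ N : ℕ, 0 < N → ∀ z : Fin N → Fin d → ℝ, (∀ i k, z i k ∈ Set.Icc (0 : ℝ) 1) →
  ∀ (i : Fin N) (ℓ : ℕ), 1 ≤ ℓ → ℓ ≤ L →
    tokenAt forward (initialInput d T N u w S z) (T + N * ℓ + (i : ℕ) + 1)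
      = promptToken d (vnetOut d act (WPfam u w (i : ℕ)) (z i) ℓ) (-(ℓ : ℤ))
          (T + N * ℓ + (i : ℕ) + 1) S

/-- The embedding `x ↦ (xᵀ, 1, 0_{d-p-1}ᵀ)ᵀ ∈ ℝ^d` of an input `x ∈ ℝ^p`. -/
def embed (d p : ℕ) (x : Fin p → ℝ) : Fin d → ℝ :=
  fun k => if h : (k : ℕ) < p then x ⟨k, h⟩ else if (k : ℕ) = p then 1 else 0

/-- The function approximator `f̂_{Θ,H^P,L,p}`: first coordinate of the token at
position `T+1+L` generated from the prompt followed by the single data token. -/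
def fhat {d : ℕ} (forward : List (Fin (4 * d + 8) → ℝ) → List (Fin (4 * d + 8) → ℝ))
    {T : ℕ} (u : Fin T → Fin d → ℝ) (w : Fin T → ℕ) (S : ℝ) (L p : ℕ)
    (x : Fin p → ℝ) : ℝ :=
  tokenAt forward (initialInput d T 1 u w S fun _ => embed d p x) (T + 1 + L)
    ⟨0, by omega⟩

/-- The unit cube `[0,1]^p`. -/
def unitCube (p : ℕ) : Set (Fin p → ℝ) := Set.Icc 0 1

/-- The sup-distance `‖f - g‖_{L^∞([0,1]^p)}`. -/
def supDist (p : ℕ) (f g : (Fin p → ℝ) → ℝ) : ℝ :=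
  ⨆ x : unitCube p, |f x.1 - g x.1|

/-- Partial derivative (within the unit cube) in coordinate direction `i`. -/
def pderivW (p : ℕ) (i : Fin p) (f : (Fin p → ℝ) → ℝ) : (Fin p → ℝ) → ℝ :=
  fun x => fderivWithin ℝ f (unitCube p) x (Pi.single i 1)

/-- Iterated partial derivative along a list of coordinate directions. -/
def pderivList (p : ℕ) : List (Fin p) → ((Fin p → ℝ) → ℝ) → (Fin p → ℝ) → ℝ
  | [], f => f
  | i :: is, f => pderivList p is (pderivW p i f)

/-- The unit ball `C_u^β([0,1]^p)` of `β`-times continuously differentiable functions with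
all partial derivatives of order `≤ β` bounded by `1` on the cube. -/
def Hclass (p β : ℕ) : Set ((Fin p → ℝ) → ℝ) :=
  {f | ContDiffOn ℝ β f (unitCube p) ∧
    ∀ ls : List (Fin p), ls.length ≤ β →
      ∀ x ∈ unitCube p, |pderivList p ls f x| ≤ 1}

/-- `U_{d,r}` : the span of the first `r` standard basis vectors of `ℝ^d`. -/
def spanFirst (d r : ℕ) : Set (Fin d → ℝ) :=
  {v | ∀ k : Fin d, r ≤ (k : ℕ) → v k = 0}

/-- Hidden layers of a standard ReLU network of width `r` (with biases). -/
def nnHidden {p r : ℕ} (W0 : Matrix (Fin r) (Fin p) ℝ) (b0 : Fin r → ℝ)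
    (Wm : ℕ → Matrix (Fin r) (Fin r) ℝ) (bm : ℕ → Fin r → ℝ) (x : Fin p → ℝ) :
    ℕ → Fin r → ℝ
  | 0 => fun i => W0.mulVec x i + b0 i
  | k + 1 => fun i =>
      (Wm k).mulVec (fun j => relu (nnHidden W0 b0 Wm bm x k j)) i + bm k i

/-- The class `N(r,p,L)` of ReLU networks `ℝ^p → ℝ` of width `r` and depth `L`
(`L` affine maps with ReLU in between). -/
def NNclass (r p L : ℕ) : Set ((Fin p → ℝ) → ℝ) :=
  {f | if L = 1 then ∃ (a : Fin p → ℝ) (b : ℝ), f = fun x => (∑ i, a i * x i) + b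
    else ∃ (W0 : Matrix (Fin r) (Fin p) ℝ) (b0 : Fin r → ℝ)
      (Wm : ℕ → Matrix (Fin r) (Fin r) ℝ) (bm : ℕ → Fin r → ℝ)
      (wL : Fin r → ℝ) (bL : ℝ),
      f = fun x => (∑ j, wL j * relu (nnHidden W0 b0 Wm bm x (L - 2) j)) + bL}

/-- Operator norm (w.r.t. the Euclidean norm) of a `d × d` matrix. -/
def opNorm {d : ℕ} (W : Matrix (Fin d) (Fin d) ℝ) : ℝ :=
  ‖LinearMap.toContinuousLinearMap (Matrix.toEuclideanLin W)‖

/-- The class `W(r,d,U,B)` of coarse weight matrices. -/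
def coarseW (d r : ℕ) (U : Set (Fin d → ℝ)) (B : ℝ) :
    Set (Matrix (Fin d) (Fin d) ℝ) :=
  {W | (∃ ut uu : Fin r → Fin d → ℝ,
        (∀ k, ut k ∈ U) ∧ (∀ k, uu k ∈ U) ∧ W = ∑ k, vecMulVec (ut k) (uu k)) ∧
    opNorm W ≤ B ^ 2}

open Classical in
/-- Number of nonzero parameter entries of one transformer layer. -/
def layerNonzero {D : ℕ} (θ : TFLayer D) : ℕ :=
  (Finset.univ.filter fun p : Fin θ.M × Fin D × Fin D => θ.Q p.1 p.2.1 p.2.2 ≠ 0).card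
  + (Finset.univ.filter fun p : Fin θ.M × Fin D × Fin D => θ.K p.1 p.2.1 p.2.2 ≠ 0).card
  + (Finset.univ.filter fun p : Fin θ.M × Fin D × Fin D => θ.V p.1 p.2.1 p.2.2 ≠ 0).card
  + (Finset.univ.filter fun p : Fin θ.width × Fin D => θ.W1 p.1 p.2 ≠ 0).card
  + (Finset.univ.filter fun p : Fin D × Fin θ.width => θ.W2 p.1 p.2 ≠ 0).card

/-- Total number of nonzero parameter entries of a transformer. -/
def tfNonzero {D : ℕ} (Θ : List (TFLayer D)) : ℕ := (Θ.map layerNonzero).sum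

/-- All parameter entries of one layer bounded in absolute value by `c`. -/
def layerEntriesBounded {D : ℕ} (θ : TFLayer D) (c : ℝ) : Prop :=
  (∀ m i j, |θ.Q m i j| ≤ c) ∧ (∀ m i j, |θ.K m i j| ≤ c) ∧ (∀ m i j, |θ.V m i j| ≤ c)
  ∧ (∀ i j, |θ.W1 i j| ≤ c) ∧ ∀ i j, |θ.W2 i j| ≤ c

end PromptTF
end

open PromptTF Matrix

namespace PromptTF

/-- Pairs of small matrices: the first acts on the `Fin p` blocks of size `d`, uniformly in the
position within the block, and the second acts on the scalar coordinates. -/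
abbrev Pattern (p q r s : ℕ) := Matrix (Fin p) (Fin r) ℝ × Matrix (Fin q) (Fin s) ℝ

/-- Splitting of `ℝ^{p d + q}` into `p` blocks of size `d` and `q` scalar coordinates. -/
def blockIdx (d p q : ℕ) : Fin (p * d + q) ≃ (Fin p × Fin d) ⊕ Fin q :=
  finSumFinEquiv.symm.trans (Equiv.sumCongr finProdFinEquiv.symm (Equiv.refl _))

/-- The vector with given blocks and scalar coordinates. -/
def blockVec {d p q : ℕ} (b : Fin p → Fin d → ℝ) (s : Fin q → ℝ) : Fin (p * d + q) → ℝ :=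
  fun i => Sum.elim (fun x => b x.1 x.2) s (blockIdx d p q i)

/-- The large matrix described by a pattern. -/
def Pattern.expand {p q r s : ℕ} (P : Pattern p q r s) (d : ℕ) :
    Matrix (Fin (p * d + q)) (Fin (r * d + s)) ℝ :=
  fun i j => Sum.elim
    (fun x => Sum.elim (fun y => if x.2 = y.2 then P.1 x.1 y.1 else 0) (fun _ => 0)
      (blockIdx d r s j))
    (fun a => Sum.elim (fun _ => 0) (fun c => P.2 a c) (blockIdx d r s j))
    (blockIdx d p q i)

lemma expand_mulVec {d p q r s : ℕ} (P : Pattern p q r s) (b : Fin r → Fin d → ℝ)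
    (t : Fin s → ℝ) :
    (P.expand d).mulVec (blockVec b t)
      = blockVec (fun a k => ∑ c, P.1 a c * b c k) (P.2.mulVec t) := by
  funext i
  simp only [Matrix.mulVec, dotProduct, Pattern.expand, blockVec]
  rw [← Equiv.sum_comp (blockIdx d r s).symm]
  simp only [Equiv.apply_symm_apply, Fintype.sum_sum_type, Sum.elim_inl, Sum.elim_inr]
  rcases blockIdx d p q i with x | a
  · simp [Fintype.sum_prod_type]
  · simp [Matrix.mulVec, dotProduct]

lemma blockVec_dotProduct {d p q : ℕ} (b b' : Fin p → Fin d → ℝ) (s s' : Fin q → ℝ) :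
    dotProduct (blockVec b s) (blockVec b' s')
      = ∑ a, ∑ k, b a k * b' a k + ∑ a, s a * s' a := by
  simp only [dotProduct, blockVec]
  rw [← Equiv.sum_comp (blockIdx d p q).symm]
  simp [Fintype.sum_prod_type]

lemma blockVec_map {d p q : ℕ} (f : ℝ → ℝ) (b : Fin p → Fin d → ℝ) (s : Fin q → ℝ) :
    (fun i => f (blockVec b s i)) = blockVec (fun a k => f (b a k)) (fun a => f (s a)) := by
  funext i
  simp only [blockVec]
  rcases blockIdx d p q i with x | a <;> rfl

lemma blockVec_add {d p q : ℕ} (b b' : Fin p → Fin d → ℝ) (s s' : Fin q → ℝ) :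
    (fun i => blockVec b s i + blockVec b' s' i)
      = blockVec (fun a k => b a k + b' a k) (fun a => s a + s' a) := by
  funext i
  simp only [blockVec]
  rcases blockIdx d p q i with x | a <;> rfl

/-- A transformer layer all of whose matrices are described by patterns. -/
structure Blueprint where
  M : ℕ
  Q : Fin M → Pattern 4 8 4 8
  K : Fin M → Pattern 4 8 4 8
  V : Fin M → Pattern 4 8 4 8
  p : ℕ
  q : ℕ
  W1 : Pattern p q 4 8
  W2 : Pattern 4 8 p q

/-- The transformer layer of token dimension `4 * d + 8` described by a blueprint. -/
def Blueprint.layer (θ : Blueprint) (d : ℕ) : TFLayer (4 * d + 8) where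
  M := θ.M
  Q m := (θ.Q m).expand d
  K m := (θ.K m).expand d
  V m := (θ.V m).expand d
  width := θ.p * d + θ.q
  W1 := θ.W1.expand d
  W2 := θ.W2.expand d

/-- A token given by its four blocks and eight scalar coordinates. -/
abbrev BTok (d : ℕ) := (Fin 4 → Fin d → ℝ) × (Fin 8 → ℝ)

/-- The action of a pattern on blocks and scalar coordinates. -/
def Pattern.act {d p q r s : ℕ} (P : Pattern p q r s)
    (h : (Fin r → Fin d → ℝ) × (Fin s → ℝ)) : (Fin p → Fin d → ℝ) × (Fin q → ℝ) :=
  (fun a k => ∑ c, P.1 a c * h.1 c k, P.2.mulVec h.2)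

/-- The attention score of a blueprint head. -/
def Blueprint.score {d : ℕ} (θ : Blueprint) (m : Fin θ.M) (h h' : BTok d) : ℝ :=
  relu (∑ a, ∑ k, ((θ.Q m).act h).1 a k * ((θ.K m).act h').1 a k
    + ∑ a, ((θ.Q m).act h).2 a * ((θ.K m).act h').2 a)

/-- The attention layer of a blueprint. -/
def Blueprint.attn {d : ℕ} (θ : Blueprint) (H : List (BTok d)) (h : BTok d) : BTok d :=
  (fun a k => h.1 a k + ∑ m, (H.map fun h' => θ.score m h h' * ((θ.V m).act h').1 a k).sum,
   fun a => h.2 a + ∑ m, (H.map fun h' => θ.score m h h' * ((θ.V m).act h').2 a).sum)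

/-- The feed-forward layer of a blueprint. -/
def Blueprint.ffn {d : ℕ} (θ : Blueprint) (h : BTok d) : BTok d :=
  (fun a k => h.1 a k + ∑ c, θ.W2.1 a c * relu ((θ.W1.act h).1 c k),
   fun a => h.2 a + ∑ c, θ.W2.2 a c * relu ((θ.W1.act h).2 c))

lemma blueprint_layerMap {d : ℕ} (θ : Blueprint) (H : List (BTok d)) :
    layerMap relu (θ.layer d) (H.map fun h => blockVec h.1 h.2)
      = (H.map fun h => θ.ffn (θ.attn H h)).map fun h => blockVec h.1 h.2 := by
  have hattn : attnOut (θ.layer d) (H.map fun h => blockVec h.1 h.2)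
      = (H.map (θ.attn H)).map fun h => blockVec h.1 h.2 := by
    simp only [attnOut, List.map_map]
    refine List.map_congr_left fun h _ => ?_
    funext i
    simp only [Function.comp_def, Blueprint.layer, Blueprint.attn, expand_mulVec,
      blockVec_dotProduct, Blueprint.score, Pattern.act]
    simp only [blockVec]
    rcases blockIdx d 4 8 i with x | a <;> rfl
  rw [layerMap, hattn]
  simp only [List.map_map]
  refine List.map_congr_left fun h _ => ?_
  have hffn : ∀ h : BTok d, (fun i => blockVec h.1 h.2 i + ((θ.W2.expand d).mulVec fun k =>
      relu ((θ.W1.expand d).mulVec (blockVec h.1 h.2) k)) i)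
      = blockVec (θ.ffn h).1 (θ.ffn h).2 := by
    intro h
    simp only [expand_mulVec, blockVec_map, blockVec_add]
    rfl
  exact hffn (θ.attn H h)

lemma promptToken_eq_blockVec {d : ℕ} (u : Fin d → ℝ) (w : ℤ) (j : ℕ) (S : ℝ) :
    promptToken d u w j S
      = blockVec (p := 4) (q := 8) ![u, 0, 0, 0] ![0, 0, 0, 0, 1, S, S * w, S * j] := by
  funext i
  obtain ⟨x, rfl⟩ := (blockIdx d 4 8).symm.surjective i
  simp only [blockVec, Equiv.apply_symm_apply]
  rcases x with ⟨b, k⟩ | s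
  · have hv : ((((blockIdx d 4 8).symm (Sum.inl (b, k)) : Fin (4 * d + 8))) : ℕ)
        = k + d * b := by
      simp [blockIdx, finProdFinEquiv]
    have hk := k.2
    unfold promptToken
    simp only [Sum.elim_inl]
    by_cases hb : b = 0
    · subst hb
      simp only [Fin.val_zero, mul_zero, add_zero] at hv
      simp [hv]
    · have hb1 : 1 ≤ (b : ℕ) := by
        have := Fin.val_ne_of_ne hb
        simp only [Fin.val_zero] at this
        omega
      have hb3 : (b : ℕ) ≤ 3 := by omega
      have hl : d * 1 ≤ d * b := Nat.mul_le_mul_left d hb1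
      have hu : d * b ≤ d * 3 := Nat.mul_le_mul_left d hb3
      rw [dif_neg (by omega), if_neg (by omega), if_neg (by omega), if_neg (by omega),
        if_neg (by omega)]
      fin_cases b
      · exact absurd rfl hb
      all_goals rfl
  · have hv : ((((blockIdx d 4 8).symm (Sum.inr s) : Fin (4 * d + 8))) : ℕ)
        = 4 * d + s := by
      simp [blockIdx]
    unfold promptToken
    simp only [Sum.elim_inr]
    rw [dif_neg (by omega), hv]
    fin_cases s <;> simp

end PromptTF


namespace PromptTF

lemma exists_abs_expand_le {ι : Type*} [Finite ι] {p q r s : ℕ} (P : ι → Pattern p q r s) :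
    ∃ c : ℕ, ∀ m d i j, |(P m).expand d i j| ≤ c := by
  obtain ⟨c₁, h₁⟩ := Finite.exists_le fun x : ι × Fin p × Fin r => |(P x.1).1 x.2.1 x.2.2|
  obtain ⟨c₂, h₂⟩ := Finite.exists_le fun x : ι × Fin q × Fin s => |(P x.1).2 x.2.1 x.2.2|
  refine ⟨⌈max c₁ c₂⌉₊, fun m d i j => ?_⟩
  have hc := Nat.le_ceil (max c₁ c₂)
  have h0 : (0 : ℝ) ≤ ⌈max c₁ c₂⌉₊ := Nat.cast_nonneg _
  simp only [Pattern.expand]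
  rcases blockIdx d p q i with x | a <;> rcases blockIdx d r s j with y | b
  · simp only [Sum.elim_inl]
    split_ifs
    · exact ((h₁ (m, x.1, y.1)).trans (le_max_left _ _)).trans hc
    · simp
  · simp
  · simp
  · exact ((h₂ (m, a, b)).trans (le_max_right _ _)).trans hc

open Classical in
lemma card_expand_ne_zero_le {p q r s : ℕ} (P : Pattern p q r s) {d : ℕ} (hd : 0 < d) :
    (Finset.univ.filter fun x : Fin (p * d + q) × Fin (r * d + s) =>
      P.expand d x.1 x.2 ≠ 0).card ≤ (p * r + q * s) * d := by
  let g : (Fin p × Fin r × Fin d) ⊕ (Fin q × Fin s) → Fin (p * d + q) × Fin (r * d + s) :=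
    Sum.elim
      (fun x => ((blockIdx d p q).symm (Sum.inl (x.1, x.2.2)),
        (blockIdx d r s).symm (Sum.inl (x.2.1, x.2.2))))
      (fun y => ((blockIdx d p q).symm (Sum.inr y.1), (blockIdx d r s).symm (Sum.inr y.2)))
  have hsub : (Finset.univ.filter fun x : Fin (p * d + q) × Fin (r * d + s) =>
      P.expand d x.1 x.2 ≠ 0) ⊆ Finset.univ.image g := by
    rintro ⟨i, j⟩ hij
    rw [Finset.mem_filter] at hij
    replace hij := hij.2
    obtain ⟨x, rfl⟩ := (blockIdx d p q).symm.surjective i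
    obtain ⟨y, rfl⟩ := (blockIdx d r s).symm.surjective j
    simp only [Pattern.expand, Equiv.apply_symm_apply] at hij
    rw [Finset.mem_image]
    rcases x with ⟨a, k⟩ | a <;> rcases y with ⟨b, l⟩ | b
    · by_cases hkl : k = l
      · subst hkl
        exact ⟨Sum.inl (a, b, k), Finset.mem_univ _, rfl⟩
      · simp [hkl] at hij
    · simp at hij
    · simp at hij
    · exact ⟨Sum.inr (a, b), Finset.mem_univ _, rfl⟩
  calc _ ≤ (Finset.univ.image g).card := Finset.card_le_card hsub
    _ ≤ _ := Finset.card_image_le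
    _ = p * r * d + q * s := by
      simp [mul_assoc]
    _ ≤ (p * r + q * s) * d := by
      rw [add_mul]
      exact Nat.add_le_add_left (Nat.le_mul_of_pos_right _ hd) _

open Classical in
lemma card_family_expand_ne_zero_le {M p q r s : ℕ} (P : Fin M → Pattern p q r s) {d : ℕ}
    (hd : 0 < d) :
    (Finset.univ.filter fun x : Fin M × Fin (p * d + q) × Fin (r * d + s) =>
      (P x.1).expand d x.2.1 x.2.2 ≠ 0).card ≤ M * (p * r + q * s) * d := by
  rw [Finset.card_filter, Fintype.sum_prod_type]
  simp only [← Finset.card_filter]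
  refine (Finset.sum_le_card_nsmul _ _ _ fun m _ => card_expand_ne_zero_le (P m) hd).trans ?_
  simp [mul_assoc]

lemma Blueprint.exists_bound (θ : Blueprint) :
    ∃ c : ℕ, ∀ d : ℕ, 0 < d → (θ.layer d).width ≤ c * d ∧ layerNonzero (θ.layer d) ≤ c * d ∧
      ∀ c' : ℝ, (c : ℝ) ≤ c' → layerEntriesBounded (θ.layer d) c' := by
  obtain ⟨cQ, hQ⟩ := exists_abs_expand_le θ.Q
  obtain ⟨cK, hK⟩ := exists_abs_expand_le θ.K
  obtain ⟨cV, hV⟩ := exists_abs_expand_le θ.V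
  obtain ⟨c1, h1⟩ := exists_abs_expand_le fun _ : Unit => θ.W1
  obtain ⟨c2, h2⟩ := exists_abs_expand_le fun _ : Unit => θ.W2
  refine ⟨(θ.p + θ.q) + (3 * (θ.M * (4 * 4 + 8 * 8)) + (θ.p * 4 + θ.q * 8)
    + (4 * θ.p + 8 * θ.q)) + (cQ + cK + cV + c1 + c2), fun d hd => ⟨?_, ?_, fun c' hc' => ?_⟩⟩
  · change θ.p * d + θ.q ≤ _
    nlinarith [Nat.zero_le (θ.p * d), Nat.zero_le (θ.M * d), Nat.zero_le (θ.q * d),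
      Nat.zero_le (cQ * d), Nat.zero_le (cK * d), Nat.zero_le (cV * d),
      Nat.zero_le (c1 * d), Nat.zero_le (c2 * d), Nat.le_mul_of_pos_right θ.q hd]
  · have e1 := card_family_expand_ne_zero_le θ.Q hd
    have e2 := card_family_expand_ne_zero_le θ.K hd
    have e3 := card_family_expand_ne_zero_le θ.V hd
    have e4 := card_expand_ne_zero_le θ.W1 hd
    have e5 := card_expand_ne_zero_le θ.W2 hd
    refine (add_le_add (add_le_add (add_le_add (add_le_add e1 e2) e3) e4) e5).trans ?_
    nlinarith [Nat.zero_le (θ.p * d), Nat.zero_le (θ.M * d), Nat.zero_le (θ.q * d),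
      Nat.zero_le (cQ * d), Nat.zero_le (cK * d), Nat.zero_le (cV * d),
      Nat.zero_le (c1 * d), Nat.zero_le (c2 * d)]
  · push_cast at hc'
    have hp : (0 : ℝ) ≤ θ.p := Nat.cast_nonneg _
    have hq : (0 : ℝ) ≤ θ.q := Nat.cast_nonneg _
    have hM : (0 : ℝ) ≤ θ.M := Nat.cast_nonneg _
    have g1 : (0 : ℝ) ≤ cQ := Nat.cast_nonneg _
    have g2 : (0 : ℝ) ≤ cK := Nat.cast_nonneg _
    have g3 : (0 : ℝ) ≤ cV := Nat.cast_nonneg _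
    have g4 : (0 : ℝ) ≤ c1 := Nat.cast_nonneg _
    have g5 : (0 : ℝ) ≤ c2 := Nat.cast_nonneg _
    exact ⟨fun m i j => (hQ m d i j).trans (by linarith),
      fun m i j => (hK m d i j).trans (by linarith),
      fun m i j => (hV m d i j).trans (by linarith),
      fun i j => (h1 () d i j).trans (by linarith),
      fun i j => (h2 () d i j).trans (by linarith)⟩

/-- Bounds of the size of a transformer given by blueprints, uniform in the block size. -/
lemma exists_bound_of_blueprints (l : List Blueprint) :
    ∃ c : ℕ, 0 < c ∧ ∀ d : ℕ, 0 < d →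
      (∀ θ ∈ l.map fun θ => θ.layer d, θ.width ≤ c * d) ∧
      tfNonzero (l.map fun θ => θ.layer d) ≤ c * d ∧
      ∀ c' : ℝ, (c : ℝ) ≤ c' → ∀ θ ∈ l.map fun θ => θ.layer d, layerEntriesBounded θ c' := by
  induction l with
  | nil => exact ⟨1, one_pos, fun d _ => by simp [tfNonzero]⟩
  | cons θ l ih =>
    obtain ⟨c, hc, h⟩ := ih
    obtain ⟨c₁, h₁⟩ := θ.exists_bound
    refine ⟨c₁ + c, by omega, fun d hd => ?_⟩
    obtain ⟨a, b, e⟩ := h d hd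
    obtain ⟨a₁, b₁, e₁⟩ := h₁ d hd
    have hle : c * d ≤ (c₁ + c) * d := Nat.mul_le_mul_right _ (by omega)
    have hle₁ : c₁ * d ≤ (c₁ + c) * d := Nat.mul_le_mul_right _ (by omega)
    simp only [List.map_cons, List.forall_mem_cons]
    refine ⟨⟨a₁.trans hle₁, fun x hx => (a x hx).trans hle⟩, ?_, fun c' hc' => ⟨e₁ c' ?_, e c' ?_⟩⟩
    · simp only [tfNonzero, List.map_cons, List.sum_cons] at b ⊢
      rw [add_mul]
      exact add_le_add b₁ b
    · push_cast at hc'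
      have : (0 : ℝ) ≤ c := Nat.cast_nonneg _
      linarith
    · push_cast at hc'
      have : (0 : ℝ) ≤ c₁ := Nat.cast_nonneg _
      linarith

end PromptTF


namespace PromptTF

/-- An attention head whose score is the positive part of an affine form in the scalar coordinates
of query and key plus `ε` times the inner product of the query block `3` with the key block `b`.
Its value is `γ` times block `0`, written to block `tb`, and `η` times the scalar `ss`, written
to the scalar `ts`. -/
structure HeadSpec where
  ε : ℝ := 0
  b : Fin 4 := 0
  α : Fin 8 → ℝ := 0
  β : Fin 8 → ℝ := 0
  δ : ℝ := 0
  γ : ℝ := 0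
  tb : Fin 4 := 0
  η : ℝ := 0
  ss : Fin 8 := 0
  ts : Fin 8 := 0

/-- The pre-activation score of a head. -/
def HeadSpec.form {d : ℕ} (s : HeadSpec) (h h' : BTok d) : ℝ :=
  s.ε * ∑ k, h.1 3 k * h'.1 s.b k + (∑ j, s.α j * h.2 j + ∑ j, s.β j * h'.2 j) + s.δ

/-- The blueprint with given heads and feed-forward patterns. -/
def Blueprint.ofHeads {M : ℕ} (hs : Fin M → HeadSpec) {p q : ℕ} (W1 : Pattern p q 4 8)
    (W2 : Pattern 4 8 p q) : Blueprint where
  M := M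
  Q m := (Matrix.single 0 3 (hs m).ε, fun i j =>
    if i = 0 then (hs m).α j + (if j = 4 then (hs m).δ else 0)
    else if i = 1 ∧ j = 4 then 1 else 0)
  K m := (Matrix.single 0 (hs m).b 1, fun i j =>
    if i = 0 ∧ j = 4 then 1 else if i = 1 then (hs m).β j else 0)
  V m := (Matrix.single (hs m).tb 0 (hs m).γ, Matrix.single (hs m).ts (hs m).ss (hs m).η)
  p := p
  q := q
  W1 := W1
  W2 := W2

lemma ofHeads_score {d M : ℕ} (hs : Fin M → HeadSpec) {p q : ℕ} (W1 : Pattern p q 4 8)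
    (W2 : Pattern 4 8 p q) (m : Fin M) (h h' : BTok d) (hh : h.2 4 = 1) (hh' : h'.2 4 = 1) :
    (Blueprint.ofHeads hs W1 W2).score m h h' = relu ((hs m).form h h') := by
  unfold Blueprint.score HeadSpec.form
  congr 1
  simp only [Blueprint.ofHeads, Pattern.act, Matrix.mulVec, dotProduct]
  have e1 : ∑ a : Fin 4, ∑ k, (∑ c, (Matrix.single 0 3 (hs m).ε : Matrix (Fin 4) (Fin 4) ℝ) a c
      * h.1 c k) * (∑ c, (Matrix.single 0 (hs m).b 1 : Matrix (Fin 4) (Fin 4) ℝ) a c * h'.1 c k)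
      = (hs m).ε * ∑ k, h.1 3 k * h'.1 (hs m).b k := by
    rw [Finset.sum_eq_single 0]
    · rw [Finset.mul_sum]
      refine Finset.sum_congr rfl fun k _ => ?_
      rw [Finset.sum_eq_single 3, Finset.sum_eq_single (hs m).b]
      · simp [mul_assoc]
      · intro c _ hc
        simp [hc.symm]
      · simp
      · intro c _ hc
        simp [hc.symm]
      · simp
    · intro a _ ha
      simp [ha.symm]
    · simp
  rw [e1]
  simp only [Fin.sum_univ_eight]
  simp [hh, hh']
  ring

lemma ofHeads_value {d M : ℕ} (hs : Fin M → HeadSpec) {p q : ℕ} (W1 : Pattern p q 4 8)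
    (W2 : Pattern 4 8 p q) (m : Fin M) (h : BTok d) :
    (((Blueprint.ofHeads hs W1 W2).V m).act h)
      = (fun a k => if a = (hs m).tb then (hs m).γ * h.1 0 k else 0,
          fun a => if a = (hs m).ts then (hs m).η * h.2 (hs m).ss else 0) := by
  simp only [Blueprint.ofHeads, Pattern.act]
  refine Prod.ext ?_ ?_
  · funext a k
    simp only
    rw [Finset.sum_eq_single 0]
    · simp [Matrix.single_apply, eq_comm]
    · intro c _ hc
      simp [hc.symm]
    · simp
  · funext a
    simp only [Matrix.mulVec, dotProduct]
    rw [Finset.sum_eq_single (hs m).ss]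
    · simp [Matrix.single_apply, eq_comm]
    · intro c _ hc
      simp [hc.symm]
    · simp

lemma sum_map_range {n : ℕ} (f : ℕ → ℝ) :
    ((List.range n).map f).sum = ∑ j ∈ Finset.range n, f j := by
  induction n with
  | zero => simp
  | succ n ih => simp [List.range_succ, Finset.sum_range_succ, ih]

lemma ofHeads_attn {d M : ℕ} (hs : Fin M → HeadSpec) {p q : ℕ} (W1 : Pattern p q 4 8)
    (W2 : Pattern 4 8 p q) (n : ℕ) (f : ℕ → BTok d) (hf : ∀ k, (f k).2 4 = 1) (h : BTok d)
    (hh : h.2 4 = 1) :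
    (Blueprint.ofHeads hs W1 W2).attn ((List.range n).map f) h
      = (fun a k => h.1 a k + ∑ m, ∑ j ∈ Finset.range n, relu ((hs m).form h (f j))
            * (if a = (hs m).tb then (hs m).γ * (f j).1 0 k else 0),
         fun a => h.2 a + ∑ m, ∑ j ∈ Finset.range n, relu ((hs m).form h (f j))
            * (if a = (hs m).ts then (hs m).η * (f j).2 (hs m).ss else 0)) := by
  have key : ∀ (m : Fin M) (g : BTok d → ℝ),
      (((List.range n).map f).map fun h' => (Blueprint.ofHeads hs W1 W2).score m h h' * g h').sum
      = ∑ j ∈ Finset.range n, relu ((hs m).form h (f j)) * g (f j) := by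
    intro m g
    rw [List.map_map, sum_map_range]
    refine Finset.sum_congr rfl fun j _ => ?_
    simp only [Function.comp_apply]
    rw [ofHeads_score hs W1 W2 m h (f j) hh (hf j)]
  refine Prod.ext ?_ ?_
  · funext a k
    simp only [Blueprint.attn]
    congr 1
    refine Finset.sum_congr rfl fun m _ => (key m fun h' => (((Blueprint.ofHeads hs W1 W2).V m).act h').1 a k).trans (Finset.sum_congr rfl fun j _ => ?_)
    exact congrArg _ (congrFun (congrFun (congrArg Prod.fst (ofHeads_value hs W1 W2 m (f j))) a) k)
  · funext a
    simp only [Blueprint.attn]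
    congr 1
    refine Finset.sum_congr rfl fun m _ => (key m fun h' => (((Blueprint.ofHeads hs W1 W2).V m).act h').2 a).trans (Finset.sum_congr rfl fun j _ => ?_)
    exact congrArg _ (congrFun (congrArg Prod.snd (ofHeads_value hs W1 W2 m (f j))) a)

lemma relu_hat {S : ℝ} (hS : 1 ≤ S) {a : ℝ} (m : ℤ) (ha : a = S * m) :
    relu (a + 1) - 2 * relu a + relu (a - 1) = if m = 0 then 1 else 0 := by
  subst ha
  unfold relu
  rcases lt_trichotomy m 0 with h | h | h
  · have hm : (m : ℝ) ≤ -1 := by exact_mod_cast Int.le_sub_one_of_lt h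
    have : S * m ≤ -1 := by nlinarith
    rw [max_eq_right (by linarith), max_eq_right (by linarith), max_eq_right (by linarith),
      if_neg h.ne]
    ring
  · subst h
    simp
  · have hm : (1 : ℝ) ≤ m := by exact_mod_cast h
    have : 1 ≤ S * m := by nlinarith
    rw [max_eq_left (by linarith), max_eq_left (by linarith), max_eq_left (by linarith),
      if_neg h.ne']
    ring

lemma relu_hat_scaled {S : ℝ} (hS : 0 ≤ S) {a : ℝ} (m : ℤ) (ha : a = S * m) :
    relu (a + S) - 2 * relu a + relu (a - S) = if m = 0 then S else 0 := by
  subst ha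
  unfold relu
  rcases lt_trichotomy m 0 with h | h | h
  · have hm : (m : ℝ) ≤ -1 := by exact_mod_cast Int.le_sub_one_of_lt h
    have : S * m ≤ -S := by nlinarith
    rw [max_eq_right (by linarith), max_eq_right (by linarith), max_eq_right (by linarith),
      if_neg h.ne]
    ring
  · subst h
    simp [hS]
  · have hm : (1 : ℝ) ≤ m := by exact_mod_cast h
    have : S ≤ S * m := by nlinarith
    rw [max_eq_left (by linarith), max_eq_left (by linarith), max_eq_left (by linarith),
      if_neg h.ne']
    ring

lemma relu_gate_int {S : ℝ} {x : ℝ} (hx : |x| ≤ S) (m : ℤ) :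
    relu (x + S * (2 * m + 1)) - relu (S * (2 * m + 1)) - relu (x + S * (2 * m - 1))
      + relu (S * (2 * m - 1)) = if m = 0 then x else 0 := by
  obtain ⟨h1, h2⟩ := abs_le.mp hx
  have hS : 0 ≤ S := (abs_nonneg x).trans hx
  unfold relu
  rcases lt_trichotomy m 0 with h | h | h
  · have hm : (m : ℝ) ≤ -1 := by exact_mod_cast Int.le_sub_one_of_lt h
    have : S * m ≤ -S := by nlinarith
    rw [max_eq_right (by linarith), max_eq_right (by linarith), max_eq_right (by linarith),
      max_eq_right (by linarith), if_neg h.ne]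
    ring
  · subst h
    norm_num
    rw [max_eq_left (by linarith), max_eq_left (by linarith), max_eq_right (by linarith),
      max_eq_right (by linarith)]
    ring
  · have hm : (1 : ℝ) ≤ m := by exact_mod_cast h
    have : S ≤ S * m := by nlinarith
    rw [max_eq_left (by linarith), max_eq_left (by linarith), max_eq_left (by linarith),
      max_eq_left (by linarith), if_neg h.ne']
    ring

lemma relu_gate_nonneg {S : ℝ} {x : ℝ} (hx : |x| ≤ S) {m : ℤ} (hm : 0 ≤ m) :
    relu (x - S * m) - relu (-x - S * m) = if m = 0 then x else 0 := by
  obtain ⟨h1, h2⟩ := abs_le.mp hx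
  unfold relu
  rcases hm.eq_or_lt with h | h
  · subst h
    norm_num
  · have hm : (1 : ℝ) ≤ m := by exact_mod_cast h
    have : S ≤ S * m := by nlinarith
    rw [max_eq_right (by linarith), max_eq_right (by linarith), if_neg h.ne']
    ring

lemma relu_sub_relu_neg (x : ℝ) : relu x - relu (-x) = x := by
  unfold relu
  rcases le_total x 0 with h | h
  · rw [max_eq_right h, max_eq_left (by linarith)]; ring
  · rw [max_eq_left h, max_eq_right (by linarith)]; ring

lemma relu_add_relu_neg (x : ℝ) : relu x + relu (-x) = |x| := by
  unfold relu
  rcases le_total x 0 with h | h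
  · rw [max_eq_right h, max_eq_left (by linarith), abs_of_nonpos h]; ring
  · rw [max_eq_left h, max_eq_right (by linarith), abs_of_nonneg h]; ring

end PromptTF


namespace PromptTF

/-- The attention heads of `lookupLayer`. -/
def lookupHeads : Fin 6 → HeadSpec :=
  ![{ α := ![0, 0, 0, 0, 0, -1, 0, -1], β := ![0, 0, 0, 0, 0, 0, 0, 1], δ := 1,
      γ := 1, tb := 1, η := 1, ss := 6, ts := 0 },
    { α := ![0, 0, 0, 0, 0, -1, 0, -1], β := ![0, 0, 0, 0, 0, 0, 0, 1], δ := 0,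
      γ := -2, tb := 1, η := -2, ss := 6, ts := 0 },
    { α := ![0, 0, 0, 0, 0, -1, 0, -1], β := ![0, 0, 0, 0, 0, 0, 0, 1], δ := -1,
      γ := 1, tb := 1, η := 1, ss := 6, ts := 0 },
    { β := ![0, 0, 0, 0, 0, 0, 1, 0], δ := 1, η := 1, ss := 5, ts := 1 },
    { β := ![0, 0, 0, 0, 0, 0, 1, 0], δ := 0, η := -2, ss := 5, ts := 1 },
    { β := ![0, 0, 0, 0, 0, 0, 1, 0], δ := -1, η := 1, ss := 5, ts := 1 }]

/-- The first layer fetches the following token into block `1` and its layer index into scalar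
`0`, and counts the data tokens in scalar `1`; the feed-forward layer then flags in scalar `2`
the consecutive layer indices, and measures in scalar `3` the distance to layer index `1`
followed by `0`. -/
def lookupLayer : Blueprint :=
  Blueprint.ofHeads lookupHeads
    (p := 0) (q := 7)
    (0, !![1, 0, 0, 0, 0, 0, 0, 0;
           -1, 0, 0, 0, 0, 0, 0, 0;
           0, 0, 0, 0, 0, -1, 1, 0;
           0, 0, 0, 0, 0, 1, -1, 0;
           1, 0, 0, 0, 0, 0, -1, 0;
           1, 0, 0, 0, 0, -1, -1, 0;
           1, 0, 0, 0, 0, -2, -1, 0])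
    (0, !![-1, 1, 0, 0, 0, 0, 0;
           0, 0, 0, 0, 0, 0, 0;
           0, 0, 0, 0, 1, -2, 1;
           1, 1, 1, 1, 0, 0, 0;
           0, 0, 0, 0, 0, 0, 0;
           0, 0, 0, 0, 0, 0, 0;
           0, 0, 0, 0, 0, 0, 0;
           0, 0, 0, 0, 0, 0, 0])

/-- The attention heads of `fetchLayer`. -/
def fetchHeads : Fin 6 → HeadSpec :=
  ![{ α := ![0, 1, 0, 0, 0, -1, 0, -1], β := ![0, 0, 0, 0, 0, 0, 0, 1], δ := 1,
      γ := 1, tb := 3, η := 1, ss := 6, ts := 0 },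
    { α := ![0, 1, 0, 0, 0, -1, 0, -1], β := ![0, 0, 0, 0, 0, 0, 0, 1], δ := 0,
      γ := -2, tb := 3, η := -2, ss := 6, ts := 0 },
    { α := ![0, 1, 0, 0, 0, -1, 0, -1], β := ![0, 0, 0, 0, 0, 0, 0, 1], δ := -1,
      γ := 1, tb := 3, η := 1, ss := 6, ts := 0 },
    { β := ![0, 0, 0, 0, 0, -1, 1, 0], δ := 1, γ := 1, tb := 2 },
    { β := ![0, 0, 0, 0, 0, -1, 1, 0], δ := 0, γ := -2, tb := 2 },
    { β := ![0, 0, 0, 0, 0, -1, 1, 0], δ := -1, γ := 1, tb := 2 }]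

/-- The second layer fetches the positive part of the token to be processed into block `3` and
its layer index into scalar `0`, and sums the tokens of layer index `1` in block `2`. -/
def fetchLayer : Blueprint :=
  Blueprint.ofHeads fetchHeads
    (p := 1) (q := 0)
    (!![0, 0, 0, -1], 0) (!![0; 0; 0; 1], 0)

/-- The attention heads of `applyLayer`. -/
def applyHeads : Fin 6 → HeadSpec :=
  ![{ ε := 1, b := 1, α := ![8, 0, 0, 0, 0, -1, 0, 0], β := ![0, 0, -2, 0, 0, 0, 4, 0],
      γ := 1, tb := 1 },
    { α := ![8, 0, 0, 0, 0, -1, 0, 0], β := ![0, 0, -2, 0, 0, 0, 4, 0], γ := -1, tb := 1 },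
    { ε := 1, b := 1, α := ![8, 0, 0, 0, 0, -3, 0, 0], β := ![0, 0, -2, 0, 0, 0, 4, 0],
      γ := -1, tb := 1 },
    { α := ![8, 0, 0, 0, 0, -3, 0, 0], β := ![0, 0, -2, 0, 0, 0, 4, 0], γ := 1, tb := 1 },
    { ε := 1, b := 2, α := ![0, 0, 0, 0, 0, 0, 1, 0], β := ![0, 0, 0, -1, 0, 0, 0, 0],
      γ := 1, tb := 1 },
    { ε := -1, b := 2, α := ![0, 0, 0, 0, 0, 0, 1, 0], β := ![0, 0, 0, -1, 0, 0, 0, 0],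
      γ := -1, tb := 1 }]

/-- The third layer applies the virtual weight matrix, accumulating the result in block `1`, and
then assembles the new token. -/
def applyLayer : Blueprint :=
  Blueprint.ofHeads applyHeads
    (p := 8) (q := 12)
    (!![1, 0, 0, 0; -1, 0, 0, 0; 0, 1, 0, 0; 0, -1, 0, 0;
        0, 0, 1, 0; 0, 0, -1, 0; 0, 0, 0, 1; 0, 0, 0, -1],
     !![1, 0, 0, 0, 0, 0, 0, 0;
        -1, 0, 0, 0, 0, 0, 0, 0;
        0, 1, 0, 0, 0, 0, 0, 0;
        0, -1, 0, 0, 0, 0, 0, 0;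
        0, 0, 1, 0, 0, 0, 0, 0;
        0, 0, -1, 0, 0, 0, 0, 0;
        0, 0, 0, 1, 0, 0, 0, 0;
        0, 0, 0, -1, 0, 0, 0, 0;
        1, 0, 0, 0, 0, -1, -1, 0;
        -1, 0, 0, 0, 0, 1, 1, 0;
        0, 0, 0, 0, 0, 1, 0, 0;
        0, 0, 0, 0, 0, -1, 0, 0])
    (!![-1, 1, 1, -1, 0, 0, 0, 0;
        0, 0, -1, 1, 0, 0, 0, 0;
        0, 0, 0, 0, -1, 1, 0, 0;
        0, 0, 0, 0, 0, 0, -1, 1],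
     !![-1, 1, 0, 0, 0, 0, 0, 0, 0, 0, 0, 0;
        0, 0, -1, 1, 0, 0, 0, 0, 0, 0, 0, 0;
        0, 0, 0, 0, -1, 1, 0, 0, 0, 0, 0, 0;
        0, 0, 0, 0, 0, 0, -1, 1, 0, 0, 0, 0;
        0, 0, 0, 0, 0, 0, 0, 0, 0, 0, 0, 0;
        0, 0, 0, 0, 0, 0, 0, 0, 0, 0, 0, 0;
        0, 0, 0, 0, 0, 0, 0, 0, 1, -1, 0, 0;
        0, 0, 0, 0, 0, 0, 0, 0, 0, 0, 1, -1])

/-- The layer without heads and hidden units. -/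
def idleLayer : Blueprint :=
  Blueprint.ofHeads (M := 0) ![] (p := 0) (q := 0) (0, 0) (0, 0)

/-- The seven layers of the emulator. -/
def emulatorLayers : List Blueprint :=
  [lookupLayer, fetchLayer, applyLayer, idleLayer, idleLayer, idleLayer, idleLayer]

lemma ofHeads_ffn {d M : ℕ} (hs : Fin M → HeadSpec) {p q : ℕ} (W1 : Pattern p q 4 8)
    (W2 : Pattern 4 8 p q) (h : BTok d) :
    (Blueprint.ofHeads hs W1 W2).ffn h
      = (fun a k => h.1 a k + ∑ c : Fin p, W2.1 a c * relu (∑ e, W1.1 c e * h.1 e k),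
         fun a => h.2 a + ∑ c : Fin q, W2.2 a c * relu (∑ e, W1.2 c e * h.2 e)) := rfl

section Step

variable {d : ℕ} (X : ℕ → Fin d → ℝ) (W : ℕ → ℤ) (S : ℝ) (n N : ℕ)

/-- The word embedding following position `k`. -/
def nextEmb (k : ℕ) : Fin d → ℝ := if k + 1 < n then X (k + 1) else 0

/-- The layer index following position `k`. -/
def nextIdx (k : ℕ) : ℤ := if k + 1 < n then W (k + 1) else 0

/-- The sum of the word embeddings of layer index `1`. -/
def oneSum : Fin d → ℝ := fun i => ∑ j ∈ Finset.range n, if W j = 1 then X j i else 0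

/-- The input token at position `k`. -/
def inTok (k : ℕ) : BTok d :=
  (![X k, 0, 0, 0], ![0, 0, 0, 0, 1, S, S * W k, S * ((k + 1 : ℕ) : ℝ)])

/-- Indicator of consecutive layer indices. -/
def consec (k : ℕ) : ℤ := if nextIdx W n k = W k + 1 then 1 else 0

/-- Distance of the layer indices at `k` and after `k` to `1` and `0`. -/
def oneZeroDist (k : ℕ) : ℤ := |W k - 1| + |nextIdx W n k|

/-- The token at position `k` after the first layer. -/
def lookupTok (k : ℕ) : BTok d :=
  (![X k, nextEmb X n k, 0, 0],
   ![0, S * N, S * consec W n k, S * oneZeroDist W n k, 1, S, S * W k, S * ((k + 1 : ℕ) : ℝ)])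

/-- The word embedding to be processed by the token at position `k`. -/
def srcEmb (k : ℕ) : Fin d → ℝ :=
  fun i => relu (∑ j ∈ Finset.range n, if j + N = k + 1 then X j i else 0)

/-- The layer index of the word embedding to be processed by the token at position `k`. -/
def srcIdx (k : ℕ) : ℤ := ∑ j ∈ Finset.range n, if j + N = k + 1 then W j else 0

/-- The token at position `k` after the second layer. -/
def fetchTok (k : ℕ) : BTok d :=
  (![X k, nextEmb X n k, oneSum X W n, srcEmb X n N k],
   ![S * srcIdx W n N k, S * N, S * consec W n k, S * oneZeroDist W n k, 1, S, S * W k,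
    S * ((k + 1 : ℕ) : ℝ)])

lemma sum_hat (hS : 1 ≤ S) (s₀ s₁ s₂ : HeadSpec) (f : ℕ → BTok d) (h : BTok d) (m : ℕ → ℤ)
    (h₀ : ∀ j, s₀.form h (f j) = S * m j + 1) (h₁ : ∀ j, s₁.form h (f j) = S * m j)
    (h₂ : ∀ j, s₂.form h (f j) = S * m j - 1) (g₀ g₁ g₂ g : ℕ → ℝ)
    (hg₀ : ∀ j, g₀ j = g j) (hg₁ : ∀ j, g₁ j = -2 * g j) (hg₂ : ∀ j, g₂ j = g j) :
    ∑ j ∈ Finset.range n, relu (s₀.form h (f j)) * g₀ j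
      + ∑ j ∈ Finset.range n, relu (s₁.form h (f j)) * g₁ j
      + ∑ j ∈ Finset.range n, relu (s₂.form h (f j)) * g₂ j
      = ∑ j ∈ Finset.range n, if m j = 0 then g j else 0 := by
  rw [← Finset.sum_add_distrib, ← Finset.sum_add_distrib]
  refine Finset.sum_congr rfl fun j _ => ?_
  have h := relu_hat hS (m j) rfl
  rw [h₀, h₁, h₂, hg₀, hg₁, hg₂]
  split_ifs with h0
  · rw [if_pos h0] at h
    linear_combination g j * h
  · rw [if_neg h0] at h
    linear_combination g j * h

lemma sum_hat_block (hS : 1 ≤ S) (s₀ s₁ s₂ : HeadSpec) (f : ℕ → BTok d) (h : BTok d)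
    (m : ℕ → ℤ) (c : ℝ) (t : Fin 4)
    (h₀ : ∀ j, s₀.form h (f j) = S * m j + 1) (h₁ : ∀ j, s₁.form h (f j) = S * m j)
    (h₂ : ∀ j, s₂.form h (f j) = S * m j - 1)
    (hγ : s₀.γ = c ∧ s₁.γ = -2 * c ∧ s₂.γ = c) (ht : s₀.tb = t ∧ s₁.tb = t ∧ s₂.tb = t)
    (a : Fin 4) (k : Fin d) :
    ∑ j ∈ Finset.range n, relu (s₀.form h (f j)) * (if a = s₀.tb then s₀.γ * (f j).1 0 k else 0)
      + ∑ j ∈ Finset.range n,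
        relu (s₁.form h (f j)) * (if a = s₁.tb then s₁.γ * (f j).1 0 k else 0)
      + ∑ j ∈ Finset.range n,
        relu (s₂.form h (f j)) * (if a = s₂.tb then s₂.γ * (f j).1 0 k else 0)
      = ∑ j ∈ Finset.range n, if m j = 0 then (if a = t then c * (f j).1 0 k else 0) else 0 := by
  obtain ⟨t0, t1, t2⟩ := ht
  obtain ⟨c0, c1, c2⟩ := hγ
  rw [t0, t1, t2, c0, c1, c2]
  refine sum_hat S n hS s₀ s₁ s₂ f h m h₀ h₁ h₂ _ _ _ _ (fun j => rfl) (fun j => ?_) (fun j => rfl)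
  split_ifs <;> ring

lemma sum_hat_scalar (hS : 1 ≤ S) (s₀ s₁ s₂ : HeadSpec) (f : ℕ → BTok d) (h : BTok d)
    (m : ℕ → ℤ) (c : ℝ) (t r : Fin 8)
    (h₀ : ∀ j, s₀.form h (f j) = S * m j + 1) (h₁ : ∀ j, s₁.form h (f j) = S * m j)
    (h₂ : ∀ j, s₂.form h (f j) = S * m j - 1)
    (hη : s₀.η = c ∧ s₁.η = -2 * c ∧ s₂.η = c) (ht : s₀.ts = t ∧ s₁.ts = t ∧ s₂.ts = t)
    (hr : s₀.ss = r ∧ s₁.ss = r ∧ s₂.ss = r) (a : Fin 8) :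
    ∑ j ∈ Finset.range n,
        relu (s₀.form h (f j)) * (if a = s₀.ts then s₀.η * (f j).2 s₀.ss else 0)
      + ∑ j ∈ Finset.range n,
        relu (s₁.form h (f j)) * (if a = s₁.ts then s₁.η * (f j).2 s₁.ss else 0)
      + ∑ j ∈ Finset.range n,
        relu (s₂.form h (f j)) * (if a = s₂.ts then s₂.η * (f j).2 s₂.ss else 0)
      = ∑ j ∈ Finset.range n, if m j = 0 then (if a = t then c * (f j).2 r else 0) else 0 := by
  obtain ⟨t0, t1, t2⟩ := ht
  obtain ⟨c0, c1, c2⟩ := hη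
  obtain ⟨r0, r1, r2⟩ := hr
  rw [t0, t1, t2, c0, c1, c2, r0, r1, r2]
  refine sum_hat S n hS s₀ s₁ s₂ f h m h₀ h₁ h₂ _ _ _ _ (fun j => rfl) (fun j => ?_) (fun j => rfl)
  split_ifs <;> ring

lemma lookupLayer_attn (hS : 1 ≤ S)
    (hN : ∑ j ∈ Finset.range n, (if W j = 0 then 1 else 0) = N) (k : ℕ) :
    lookupLayer.attn ((List.range n).map (inTok X W S)) (inTok X W S k)
      = (![X k, nextEmb X n k, 0, 0],
         ![S * nextIdx W n k, S * N, 0, 0, 1, S, S * W k, S * ((k + 1 : ℕ) : ℝ)]) := by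
  have hpick : ∀ g : ℕ → ℝ, (∑ j ∈ Finset.range n, if (j : ℤ) - (k + 1) = 0 then g j else 0)
      = if k + 1 < n then g (k + 1) else 0 := by
    intro g
    have e := Finset.sum_ite_eq' (Finset.range n) (k + 1) g
    simp only [Finset.mem_range] at e
    rw [← e]
    refine Finset.sum_congr rfl fun j _ => ?_
    congr 1
    exact propext ⟨fun h => by omega, fun h => by omega⟩
  have a0 : ∀ j, (lookupHeads 0).form (inTok X W S k) (inTok X W S j)
      = S * ((j : ℤ) - (k + 1) : ℤ) + 1 := by
    intro j
    simp [HeadSpec.form, inTok, Fin.sum_univ_eight, lookupHeads]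
    ring
  have a1 : ∀ j, (lookupHeads 1).form (inTok X W S k) (inTok X W S j)
      = S * ((j : ℤ) - (k + 1) : ℤ) := by
    intro j
    simp [HeadSpec.form, inTok, Fin.sum_univ_eight, lookupHeads]
    ring
  have a2 : ∀ j, (lookupHeads 2).form (inTok X W S k) (inTok X W S j)
      = S * ((j : ℤ) - (k + 1) : ℤ) - 1 := by
    intro j
    simp [HeadSpec.form, inTok, Fin.sum_univ_eight, lookupHeads]
    ring
  have a3 : ∀ j, (lookupHeads 3).form (inTok X W S k) (inTok X W S j) = S * W j + 1 := by
    intro j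
    simp [HeadSpec.form, inTok, Fin.sum_univ_eight, lookupHeads]
  have a4 : ∀ j, (lookupHeads 4).form (inTok X W S k) (inTok X W S j) = S * W j := by
    intro j
    simp [HeadSpec.form, inTok, Fin.sum_univ_eight, lookupHeads]
  have a5 : ∀ j, (lookupHeads 5).form (inTok X W S k) (inTok X W S j) = S * W j - 1 := by
    intro j
    simp [HeadSpec.form, inTok, Fin.sum_univ_eight, lookupHeads]
    ring
  rw [lookupLayer, ofHeads_attn _ _ _ _ _ (fun _ => rfl) _ rfl]
  refine Prod.ext ?_ ?_
  · funext a i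
    have A := sum_hat_block S n hS _ _ _ (inTok X W S) (inTok X W S k) _ 1 1 a0 a1 a2
      ⟨rfl, show (-2 : ℝ) = -2 * 1 by norm_num, rfl⟩ ⟨rfl, rfl, rfl⟩ a i
    have B := sum_hat_block S n hS _ _ _ (inTok X W S) (inTok X W S k) _ 0 0 a3 a4 a5
      ⟨rfl, show (0 : ℝ) = -2 * 0 by norm_num, rfl⟩ ⟨rfl, rfl, rfl⟩ a i
    rw [hpick] at A
    simp only [Fin.sum_univ_six]
    trans (inTok X W S k).1 a i + (if k + 1 < n then
      (if a = 1 then 1 * (inTok X W S (k + 1)).1 0 i else 0) else 0)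
    · rw [← A]
      simp only [zero_mul, ite_self, Finset.sum_const_zero] at B
      linear_combination B
    · fin_cases a <;> simp [inTok, nextEmb]
      split_ifs <;> rfl
  · funext a
    have A := sum_hat_scalar S n hS _ _ _ (inTok X W S) (inTok X W S k) _ 1 0 6 a0 a1 a2
      ⟨rfl, show (-2 : ℝ) = -2 * 1 by norm_num, rfl⟩ ⟨rfl, rfl, rfl⟩ ⟨rfl, rfl, rfl⟩ a
    have B := sum_hat_scalar S n hS _ _ _ (inTok X W S) (inTok X W S k) _ 1 1 5 a3 a4 a5
      ⟨rfl, show (-2 : ℝ) = -2 * 1 by norm_num, rfl⟩ ⟨rfl, rfl, rfl⟩ ⟨rfl, rfl, rfl⟩ a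
    rw [hpick] at A
    simp only [Fin.sum_univ_six]
    trans (inTok X W S k).2 a + (if k + 1 < n then
      (if a = 0 then 1 * (inTok X W S (k + 1)).2 6 else 0) else 0)
      + ∑ j ∈ Finset.range n, if W j = 0 then (if a = 1 then 1 * (inTok X W S j).2 5 else 0) else 0
    · rw [← A, ← B]
      ring
    · fin_cases a <;> simp [inTok, nextIdx]
      · rw [← hN, Finset.sum_ite]
        simp [mul_comm]

lemma lookupLayer_ffn (hS : 0 ≤ S) (k : ℕ) :
    lookupLayer.ffn ((![X k, nextEmb X n k, 0, 0],
         ![S * nextIdx W n k, S * N, 0, 0, 1, S, S * W k, S * ((k + 1 : ℕ) : ℝ)]) : BTok d)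
      = lookupTok X W S n N k := by
  have h1 := relu_hat_scaled hS (nextIdx W n k - (W k + 1)) rfl
  have h2 := relu_add_relu_neg (S * nextIdx W n k)
  have h2' := relu_sub_relu_neg (S * nextIdx W n k)
  have h3 := relu_add_relu_neg (S * W k - S)
  have e2 : |S * (nextIdx W n k : ℝ)| = S * |(nextIdx W n k : ℝ)| := by
    rw [abs_mul, abs_of_nonneg hS]
  have e3 : |S * (W k : ℝ) - S| = S * |(W k : ℝ) - 1| := by
    rw [← abs_of_nonneg hS, ← abs_mul, abs_of_nonneg hS]; congr 1; ring
  rw [lookupLayer, ofHeads_ffn]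
  refine Prod.ext ?_ ?_
  · funext a i
    simp [lookupTok]
  · funext a
    fin_cases a <;> simp [lookupTok, Fin.sum_univ_seven, Fin.sum_univ_eight]
    · linear_combination -h2'
    · trans if nextIdx W n k - (W k + 1) = 0 then S else 0
      · rw [← h1]
        push_cast
        ring_nf
      · simp [consec, sub_eq_zero]
    · trans |S * (nextIdx W n k : ℝ)| + |S * (W k : ℝ) - S|
      · rw [← h2, ← h3]
        ring_nf
      · rw [e2, e3]
        simp only [oneZeroDist]
        push_cast
        ring

lemma fetchLayer_attn (hS : 1 ≤ S) (k : ℕ) :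
    fetchLayer.attn ((List.range n).map (lookupTok X W S n N)) (lookupTok X W S n N k)
      = (![X k, nextEmb X n k, oneSum X W n,
            fun i => ∑ j ∈ Finset.range n, if j + N = k + 1 then X j i else 0],
         ![S * srcIdx W n N k, S * N, S * consec W n k, S * oneZeroDist W n k, 1, S, S * W k,
           S * ((k + 1 : ℕ) : ℝ)]) := by
  have hpick : ∀ g : ℕ → ℝ,
      (∑ j ∈ Finset.range n, if ((j : ℤ) + N - (k + 1) : ℤ) = 0 then g j else 0)
      = ∑ j ∈ Finset.range n, if j + N = k + 1 then g j else 0 := by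
    intro g
    refine Finset.sum_congr rfl fun j _ => ?_
    congr 1
    exact propext ⟨fun h => by omega, fun h => by omega⟩
  have hone : ∀ g : ℕ → ℝ, (∑ j ∈ Finset.range n, if W j - 1 = 0 then g j else 0)
      = ∑ j ∈ Finset.range n, if W j = 1 then g j else 0 := by
    intro g
    simp only [sub_eq_zero]
  have a0 : ∀ j, (fetchHeads 0).form (lookupTok X W S n N k) (lookupTok X W S n N j)
      = S * ((j : ℤ) + N - (k + 1) : ℤ) + 1 := by
    intro j
    simp [HeadSpec.form, lookupTok, Fin.sum_univ_eight, fetchHeads]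
    ring
  have a1 : ∀ j, (fetchHeads 1).form (lookupTok X W S n N k) (lookupTok X W S n N j)
      = S * ((j : ℤ) + N - (k + 1) : ℤ) := by
    intro j
    simp [HeadSpec.form, lookupTok, Fin.sum_univ_eight, fetchHeads]
    ring
  have a2 : ∀ j, (fetchHeads 2).form (lookupTok X W S n N k) (lookupTok X W S n N j)
      = S * ((j : ℤ) + N - (k + 1) : ℤ) - 1 := by
    intro j
    simp [HeadSpec.form, lookupTok, Fin.sum_univ_eight, fetchHeads]
    ring
  have a3 : ∀ j, (fetchHeads 3).form (lookupTok X W S n N k) (lookupTok X W S n N j)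
      = S * (W j - 1 : ℤ) + 1 := by
    intro j
    simp [HeadSpec.form, lookupTok, Fin.sum_univ_eight, fetchHeads]
    ring
  have a4 : ∀ j, (fetchHeads 4).form (lookupTok X W S n N k) (lookupTok X W S n N j)
      = S * (W j - 1 : ℤ) := by
    intro j
    simp [HeadSpec.form, lookupTok, Fin.sum_univ_eight, fetchHeads]
    ring
  have a5 : ∀ j, (fetchHeads 5).form (lookupTok X W S n N k) (lookupTok X W S n N j)
      = S * (W j - 1 : ℤ) - 1 := by
    intro j
    simp [HeadSpec.form, lookupTok, Fin.sum_univ_eight, fetchHeads]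
    ring
  rw [fetchLayer, ofHeads_attn _ _ _ _ _ (fun _ => rfl) _ rfl]
  refine Prod.ext ?_ ?_
  · funext a i
    have A := sum_hat_block S n hS _ _ _ (lookupTok X W S n N) (lookupTok X W S n N k) _ 1 3
      a0 a1 a2 ⟨rfl, show (-2 : ℝ) = -2 * 1 by norm_num, rfl⟩ ⟨rfl, rfl, rfl⟩ a i
    have B := sum_hat_block S n hS _ _ _ (lookupTok X W S n N) (lookupTok X W S n N k) _ 1 2
      a3 a4 a5 ⟨rfl, show (-2 : ℝ) = -2 * 1 by norm_num, rfl⟩ ⟨rfl, rfl, rfl⟩ a i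
    rw [hpick] at A
    rw [hone] at B
    simp only [Fin.sum_univ_six]
    trans (lookupTok X W S n N k).1 a i + (∑ j ∈ Finset.range n, if j + N = k + 1 then
        (if a = 3 then 1 * (lookupTok X W S n N j).1 0 i else 0) else 0)
      + ∑ j ∈ Finset.range n, if W j = 1 then
        (if a = 2 then 1 * (lookupTok X W S n N j).1 0 i else 0) else 0
    · rw [← A, ← B]
      ring
    · fin_cases a <;> simp [lookupTok, oneSum]
  · funext a
    have A := sum_hat_scalar S n hS _ _ _ (lookupTok X W S n N) (lookupTok X W S n N k) _ 1 0 6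
      a0 a1 a2 ⟨rfl, show (-2 : ℝ) = -2 * 1 by norm_num, rfl⟩ ⟨rfl, rfl, rfl⟩ ⟨rfl, rfl, rfl⟩ a
    have B := sum_hat_scalar S n hS _ _ _ (lookupTok X W S n N) (lookupTok X W S n N k) _ 0 0 0
      a3 a4 a5 ⟨rfl, show (0 : ℝ) = -2 * 0 by norm_num, rfl⟩ ⟨rfl, rfl, rfl⟩ ⟨rfl, rfl, rfl⟩ a
    rw [hpick] at A
    simp only [Fin.sum_univ_six]
    trans (lookupTok X W S n N k).2 a + ∑ j ∈ Finset.range n, if j + N = k + 1 then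
        (if a = 0 then 1 * (lookupTok X W S n N j).2 6 else 0) else 0
    · rw [← A]
      simp only [zero_mul, ite_self, Finset.sum_const_zero] at B
      linear_combination B
    · fin_cases a <;> simp [lookupTok, srcIdx, Finset.mul_sum]

lemma fetchLayer_ffn (k : ℕ) :
    fetchLayer.ffn ((![X k, nextEmb X n k, oneSum X W n,
            fun i => ∑ j ∈ Finset.range n, if j + N = k + 1 then X j i else 0],
         ![S * srcIdx W n N k, S * N, S * consec W n k, S * oneZeroDist W n k, 1, S, S * W k,
           S * ((k + 1 : ℕ) : ℝ)]) : BTok d)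
      = fetchTok X W S n N k := by
  rw [fetchLayer, ofHeads_ffn]
  refine Prod.ext ?_ ?_
  · funext a i
    fin_cases a <;> simp [fetchTok, srcEmb, Fin.sum_univ_four]
    have h := relu_sub_relu_neg (∑ j ∈ Finset.range n, if j + N = k + 1 then X j i else 0)
    linear_combination -h
  · funext a
    simp [fetchTok]

end Step
end PromptTF


namespace PromptTF

section Apply

variable {d : ℕ} (X : ℕ → Fin d → ℝ) (W : ℕ → ℤ) (S : ℝ) (n N : ℕ)

/-- The word embedding generated after the first `n` tokens. -/
def outEmb : Fin d → ℝ := fun i =>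
  ∑ j ∈ Finset.range n,
    ((if nextIdx W n j = W j + 1 ∧ W j = 1 - 2 * srcIdx W n N (n - 1) then
        ∑ k, srcEmb X n N (n - 1) k * nextEmb X n j k else 0) * X j i
      + (if W j = 1 ∧ nextIdx W n j = 0 ∧ W (n - 1) = 0 then
        ∑ k, srcEmb X n N (n - 1) k * oneSum X W n k else 0) * X j i)

lemma applyLayer_attn (hn : 0 < n)
    (hb₁ : ∀ j < n, |∑ k, srcEmb X n N (n - 1) k * nextEmb X n j k| ≤ S)
    (hb₂ : |∑ k, srcEmb X n N (n - 1) k * oneSum X W n k| ≤ S) (hW : W (n - 1) ≤ 0) :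
    applyLayer.attn ((List.range n).map (fetchTok X W S n N)) (fetchTok X W S n N (n - 1))
      = (![X (n - 1), outEmb X W n N, oneSum X W n, srcEmb X n N (n - 1)],
         ![S * srcIdx W n N (n - 1), S * N, S * consec W n (n - 1), S * oneZeroDist W n (n - 1),
           1, S, S * W (n - 1), S * (n : ℝ)]) := by
  have hnn : n - 1 + 1 = n := by omega
  have hnc : ((n - 1 : ℕ) : ℝ) + 1 = n := by exact_mod_cast congrArg (Nat.cast (R := ℝ)) hnn
  have key : ∀ j ∈ Finset.range n, ∀ i,
      relu ((applyHeads 0).form (fetchTok X W S n N (n - 1)) (fetchTok X W S n N j)) * X j i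
      - relu ((applyHeads 1).form (fetchTok X W S n N (n - 1)) (fetchTok X W S n N j)) * X j i
      - relu ((applyHeads 2).form (fetchTok X W S n N (n - 1)) (fetchTok X W S n N j)) * X j i
      + relu ((applyHeads 3).form (fetchTok X W S n N (n - 1)) (fetchTok X W S n N j)) * X j i
      + relu ((applyHeads 4).form (fetchTok X W S n N (n - 1)) (fetchTok X W S n N j)) * X j i
      - relu ((applyHeads 5).form (fetchTok X W S n N (n - 1)) (fetchTok X W S n N j)) * X j i
      = (if nextIdx W n j = W j + 1 ∧ W j = 1 - 2 * srcIdx W n N (n - 1) then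
        ∑ k, srcEmb X n N (n - 1) k * nextEmb X n j k else 0) * X j i
      + (if W j = 1 ∧ nextIdx W n j = 0 ∧ W (n - 1) = 0 then
        ∑ k, srcEmb X n N (n - 1) k * oneSum X W n k else 0) * X j i := by
    intro j hj i
    have G1 := relu_gate_int (hb₁ j (Finset.mem_range.mp hj))
      (2 * W j - 1 - consec W n j + 4 * srcIdx W n N (n - 1))
    have G2 := relu_gate_nonneg hb₂ (m := oneZeroDist W n j - W (n - 1))
      (by have : 0 ≤ oneZeroDist W n j := by unfold oneZeroDist; positivity
          omega)
    have c1 : (2 * W j - 1 - consec W n j + 4 * srcIdx W n N (n - 1) = 0) ↔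
        (nextIdx W n j = W j + 1 ∧ W j = 1 - 2 * srcIdx W n N (n - 1)) := by
      unfold consec
      split_ifs <;> omega
    have c2 : (oneZeroDist W n j - W (n - 1) = 0) ↔
        (W j = 1 ∧ nextIdx W n j = 0 ∧ W (n - 1) = 0) := by
      unfold oneZeroDist
      constructor
      · intro h
        have := abs_nonneg (W j - 1)
        have := abs_nonneg (nextIdx W n j)
        have e1 : |W j - 1| = 0 := by omega
        have e2 : |nextIdx W n j| = 0 := by omega
        rw [abs_eq_zero] at e1 e2
        exact ⟨by omega, e2, by omega⟩
      · rintro ⟨h1, h2, h3⟩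
        simp [h1, h2, h3]
    simp only [c1] at G1
    simp only [c2] at G2
    rw [← G1, ← G2]
    push_cast
    simp [HeadSpec.form, fetchTok, Fin.sum_univ_eight, applyHeads]
    ring_nf
  rw [applyLayer, ofHeads_attn _ _ _ _ _ (fun _ => rfl) _ rfl]
  refine Prod.ext ?_ ?_
  · funext a i
    simp only [Fin.sum_univ_six, ← Finset.sum_add_distrib]
    by_cases ha : a = 1
    · subst ha
      have e : (fetchTok X W S n N (n - 1)).1 1 i = 0 := by simp [fetchTok, nextEmb, hnn]
      rw [e, zero_add]
      refine Finset.sum_congr rfl fun j hj => ?_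
      rw [← key j hj i]
      simp [applyHeads, fetchTok]
      ring
    · have e : ∀ m, a ≠ (applyHeads m).tb := by
        intro m
        fin_cases m <;> exact ha
      simp only [e, if_false, mul_zero, add_zero, Finset.sum_const_zero]
      fin_cases a <;> first | rfl | exact absurd rfl ha
  · funext a
    have e : ∀ m, (applyHeads m).η = 0 := by
      intro m
      fin_cases m <;> rfl
    simp only [e, zero_mul, ite_self, mul_zero, Finset.sum_const_zero, add_zero]
    fin_cases a <;> simp [fetchTok, hnn]

lemma applyLayer_ffn (y o t x : Fin d → ℝ) (a b c e w : ℝ) :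
    applyLayer.ffn ((![x, o, t, y], ![a, b, c, e, 1, S, w, S * n]) : BTok d)
      = (![o, 0, 0, 0], ![0, 0, 0, 0, 1, S, a - S, S * ((n + 1 : ℕ) : ℝ)]) := by
  rw [applyLayer, ofHeads_ffn]
  have h := relu_sub_relu_neg
  refine Prod.ext ?_ ?_
  · funext a i
    fin_cases a <;> simp [Fin.sum_univ_four, Fin.sum_univ_eight]
    · linear_combination -h (x i) + h (o i)
    · linear_combination - h (o i)
    · linear_combination - h (t i)
    · linear_combination - h (y i)
  · funext a'
    have e12 : ∀ f : Fin 12 → ℝ, ∑ i, f i = f 0 + f 1 + f 2 + f 3 + f 4 + f 5 + f 6 + f 7 + f 8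
        + f 9 + f 10 + f 11 := by
      intro f
      simp [Fin.sum_univ_succ]
      ring
    fin_cases a' <;> simp [e12, Fin.sum_univ_eight]
    · linear_combination - h a
    · linear_combination - h b
    · linear_combination - h c
    · linear_combination - h e
    · have := h (a - S - w)
      ring_nf at this ⊢
      linear_combination this
    · have := h S
      linear_combination this

lemma idleLayer_map (H : List (BTok d)) :
    (H.map fun h => idleLayer.ffn (idleLayer.attn H h)) = H := by
  rw [List.map_congr_left (g := id)]
  · simp
  · intro h _
    refine Prod.ext ?_ ?_
    · funext a i
      simp only [idleLayer, ofHeads_ffn, Finset.univ_eq_empty, Finset.sum_empty, add_zero]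
      simp only [Blueprint.attn, id_eq, add_eq_left]
      exact Finset.sum_eq_zero fun m _ => Fin.elim0 m
    · funext a
      simp only [idleLayer, ofHeads_ffn, Finset.univ_eq_empty, Finset.sum_empty, add_zero]
      simp only [Blueprint.attn, id_eq, add_eq_left]
      exact Finset.sum_eq_zero fun m _ => Fin.elim0 m

/-- One pass of the emulator generates the token determined by `outEmb` and `srcIdx`. -/
lemma getLastD_emulator (hn : 0 < n) (hS : 1 ≤ S)
    (hN : ∑ j ∈ Finset.range n, (if W j = 0 then 1 else 0) = N)
    (hb₁ : ∀ j < n, |∑ k, srcEmb X n N (n - 1) k * nextEmb X n j k| ≤ S)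
    (hb₂ : |∑ k, srcEmb X n N (n - 1) k * oneSum X W n k| ≤ S) (hW : W (n - 1) ≤ 0) :
    (tfForward (emulatorLayers.map fun θ => θ.layer d)
      ((List.range n).map fun k => promptToken d (X k) (W k) (k + 1) S)).getLastD (fun _ => 0)
      = promptToken d (outEmb X W n N) (srcIdx W n N (n - 1) - 1) (n + 1) S := by
  have e0 : ((List.range n).map fun k => promptToken d (X k) (W k) (k + 1) S)
      = ((List.range n).map (inTok X W S)).map fun h => blockVec h.1 h.2 := by
    rw [List.map_map]
    refine List.map_congr_left fun k _ => ?_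
    rw [promptToken_eq_blockVec]
    rfl
  have e1 : (((List.range n).map (inTok X W S)).map fun h =>
      lookupLayer.ffn (lookupLayer.attn ((List.range n).map (inTok X W S)) h))
      = (List.range n).map (lookupTok X W S n N) := by
    rw [List.map_map]
    refine List.map_congr_left fun k _ => ?_
    rw [Function.comp_apply, lookupLayer_attn X W S n N hS hN,
      lookupLayer_ffn X W S n N (zero_le_one.trans hS)]
  have e2 : (((List.range n).map (lookupTok X W S n N)).map fun h =>
      fetchLayer.ffn (fetchLayer.attn ((List.range n).map (lookupTok X W S n N)) h))
      = (List.range n).map (fetchTok X W S n N) := by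
    rw [List.map_map]
    refine List.map_congr_left fun k _ => ?_
    rw [Function.comp_apply, fetchLayer_attn X W S n N hS, fetchLayer_ffn]
  simp only [emulatorLayers, List.map_cons, List.map_nil, tfForward, List.foldl_cons,
    List.foldl_nil]
  rw [e0, blueprint_layerMap, e1, blueprint_layerMap, e2]
  simp only [blueprint_layerMap, idleLayer_map]
  obtain ⟨n', rfl⟩ : ∃ n', n = n' + 1 := ⟨n - 1, by omega⟩
  have h := applyLayer_attn X W S (n' + 1) N hn hb₁ hb₂ hW
  simp only [Nat.add_sub_cancel] at h ⊢
  rw [List.range_succ] at h ⊢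
  simp only [List.map_append, List.map_cons, List.map_nil, List.getLastD_concat] at h ⊢
  rw [h, applyLayer_ffn, promptToken_eq_blockVec]
  have e : S * (srcIdx W (n' + 1) N n' : ℝ) - S
      = S * ((srcIdx W (n' + 1) N n' - 1 : ℤ) : ℝ) := by
    push_cast
    ring
  rw [e]

end Apply
end PromptTF


namespace PromptTF

section Weights

variable {d T : ℕ} (u : Fin T → Fin d → ℝ) (w : Fin T → ℕ) (X : ℕ → Fin d → ℝ) (W : ℕ → ℤ)

lemma WPmat_mulVec (hX : ∀ j (h : j < T), X j = u ⟨j, h⟩) (hW : ∀ j (h : j < T), W j = w ⟨j, h⟩)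
    {ℓ : ℕ} (hℓ : 1 ≤ ℓ) (y : Fin d → ℝ) :
    (WPmat u w ℓ).mulVec y = ∑ j ∈ Finset.range (T - 1),
      if W j = 2 * ℓ - 1 ∧ W (j + 1) = 2 * ℓ then (∑ k, y k * X (j + 1) k) • X j else 0 := by
  rcases T with _ | T
  · simp [WPmat]
  rw [WPmat, Fin.sum_univ_castSucc, Nat.add_sub_cancel, Finset.sum_range]
  simp only [Fin.val_castSucc, Fin.val_last, lt_irrefl, dif_neg, not_false_eq_true, add_zero]
  rw [Matrix.sum_mulVec]
  refine Finset.sum_congr rfl fun j _ => ?_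
  have h1 : (j : ℕ) + 1 < T + 1 := by omega
  rw [dif_pos h1, hX j (by omega), hW j (by omega), hX _ h1, hW _ h1]
  have hc : ((w ⟨j, by omega⟩ : ℤ) = 2 * ℓ - 1 ∧ (w ⟨j + 1, h1⟩ : ℤ) = 2 * ℓ) ↔
      (w j.castSucc = 2 * ℓ - 1 ∧ w ⟨j + 1, h1⟩ = 2 * ℓ) := by
    rw [show (⟨(j : ℕ), by omega⟩ : Fin (T + 1)) = j.castSucc from rfl]
    omega
  simp only [hc]
  split_ifs
  · ext i
    simp only [Matrix.mulVec, dotProduct, Matrix.vecMulVec_apply, Pi.smul_apply, smul_eq_mul,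
      Finset.sum_mul]
    refine Finset.sum_congr rfl fun k _ => ?_
    rw [show (⟨(j : ℕ), by omega⟩ : Fin (T + 1)) = j.castSucc from rfl]
    ring
  · simp

lemma WPcorr_mulVec (hX : ∀ j (h : j < T), X j = u ⟨j, h⟩)
    (hW : ∀ j (h : j < T), W j = w ⟨j, h⟩) (hT : 0 < T) (y : Fin d → ℝ) :
    (WPcorr u w).mulVec y
      = if W (T - 1) = 1 then (∑ k, y k * oneSum X W T k) • X (T - 1) else 0 := by
  have hs : (∑ j : Fin T, if w j = 1 then u j else 0) = oneSum X W T := by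
    ext i
    rw [oneSum, Finset.sum_range, Finset.sum_apply]
    refine Finset.sum_congr rfl fun j _ => ?_
    rw [hX j j.2, hW j j.2]
    norm_cast
    split_ifs <;> rfl
  rw [WPcorr, dif_pos hT, hX _ (by omega), hW _ (by omega), hs]
  norm_cast
  split_ifs
  · ext i
    simp only [Matrix.mulVec, dotProduct, Matrix.vecMulVec_apply, Pi.smul_apply, smul_eq_mul,
      Finset.sum_mul]
    refine Finset.sum_congr rfl fun k _ => ?_
    ring
  · simp

end Weights

section Norms

variable {d : ℕ}

/-- The Euclidean norm. -/
noncomputable def l2 (x : Fin d → ℝ) : ℝ := Real.sqrt (∑ k, x k ^ 2)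

lemma l2_eq_norm (x : Fin d → ℝ) : l2 x = ‖(WithLp.toLp 2 x : EuclideanSpace ℝ (Fin d))‖ := by
  simp [l2, EuclideanSpace.norm_eq]

lemma l2_nonneg (x : Fin d → ℝ) : 0 ≤ l2 x := Real.sqrt_nonneg _

lemma l2_zero : l2 (0 : Fin d → ℝ) = 0 := by simp [l2]

lemma l2_add_le (x y : Fin d → ℝ) : l2 (x + y) ≤ l2 x + l2 y := by
  simp only [l2_eq_norm, WithLp.toLp_add]
  exact norm_add_le _ _

lemma l2_smul (c : ℝ) (x : Fin d → ℝ) : l2 (c • x) = |c| * l2 x := by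
  simp only [l2_eq_norm, WithLp.toLp_smul, norm_smul, Real.norm_eq_abs]

lemma l2_sum_le {ι : Type*} (s : Finset ι) (f : ι → Fin d → ℝ) :
    l2 (∑ j ∈ s, f j) ≤ ∑ j ∈ s, l2 (f j) :=
  Finset.le_sum_of_subadditive l2 l2_zero.le l2_add_le s f

lemma abs_dot_le (x y : Fin d → ℝ) : |∑ k, x k * y k| ≤ l2 x * l2 y := by
  rw [l2, l2, ← Real.sqrt_mul (Finset.sum_nonneg fun _ _ => sq_nonneg _)]
  exact Real.abs_le_sqrt (Finset.sum_mul_sq_le_sq_mul_sq _ _ _)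

lemma l2_relu_le (x : Fin d → ℝ) : l2 (fun k => relu (x k)) ≤ l2 x := by
  refine Real.sqrt_le_sqrt (Finset.sum_le_sum fun k _ => ?_)
  rw [← sq_abs (x k)]
  have h : 0 ≤ relu (x k) := le_max_right _ _
  exact pow_le_pow_left₀ h (max_le (le_abs_self _) (abs_nonneg _)) 2

lemma l2_le_sqrt {z : Fin d → ℝ} (hz : ∀ k, z k ∈ Set.Icc (0 : ℝ) 1) : l2 z ≤ Real.sqrt d := by
  refine Real.sqrt_le_sqrt ?_
  calc ∑ k, z k ^ 2 ≤ ∑ _k : Fin d, (1 : ℝ) :=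
        Finset.sum_le_sum fun k _ => pow_le_one₀ (hz k).1 (hz k).2
    _ = d := by simp

lemma l2_sum_ite_le {B : ℝ} (s : Finset ℕ) (p : ℕ → Prop) [DecidablePred p]
    (f : ℕ → Fin d → ℝ) (hf : ∀ j ∈ s, l2 (f j) ≤ B) :
    l2 (∑ j ∈ s, if p j then f j else 0) ≤ (s.filter p).card * B := by
  refine (l2_sum_le _ _).trans ?_
  rw [← nsmul_eq_mul, ← Finset.sum_const, Finset.sum_filter]
  refine Finset.sum_le_sum fun j hj => ?_
  split_ifs
  · exact hf j hj
  · exact l2_zero.le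

lemma oneSum_eq_sum (X : ℕ → Fin d → ℝ) (W : ℕ → ℤ) (n : ℕ) :
    oneSum X W n = ∑ j ∈ Finset.range n, if W j = 1 then X j else 0 := by
  ext i
  rw [oneSum, Finset.sum_apply]
  refine Finset.sum_congr rfl fun j _ => ?_
  split_ifs <;> rfl

variable {T : ℕ} (u : Fin T → Fin d → ℝ) (w : Fin T → ℕ) (X : ℕ → Fin d → ℝ) (W : ℕ → ℤ)

lemma l2_smul_dot_le {B : ℝ} (y a b : Fin d → ℝ) (ha : l2 a ≤ B) {C : ℝ} (hb : l2 b ≤ C) :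
    l2 ((∑ k, y k * b k) • a) ≤ C * B * l2 y := by
  rw [l2_smul]
  calc |∑ k, y k * b k| * l2 a ≤ (l2 y * l2 b) * l2 a :=
        mul_le_mul_of_nonneg_right (abs_dot_le _ _) (l2_nonneg _)
    _ ≤ (l2 y * C) * B := by
        have := l2_nonneg a
        have := l2_nonneg b
        have := l2_nonneg y
        gcongr
        exact mul_nonneg (by assumption) ((l2_nonneg b).trans hb)
    _ = _ := by ring

lemma l2_WPfam_mulVec_le (hX : ∀ j (h : j < T), X j = u ⟨j, h⟩)
    (hW : ∀ j (h : j < T), W j = w ⟨j, h⟩) (hT : 0 < T) {B : ℝ} (hB : ∀ j < T, l2 (X j) ≤ B)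
    (i : ℕ) {ℓ : ℕ} (hℓ : 1 ≤ ℓ) (y : Fin d → ℝ) :
    l2 ((WPfam u w i ℓ).mulVec y) ≤ T * (B * B * l2 y) := by
  have hB0 : 0 ≤ B := (l2_nonneg _).trans (hB 0 hT)
  have hC : 0 ≤ B * B * l2 y := mul_nonneg (mul_nonneg hB0 hB0) (l2_nonneg y)
  have h1 : ∀ {ℓ : ℕ}, 1 ≤ ℓ → l2 ((WPmat u w ℓ).mulVec y) ≤
      ((Finset.range (T - 1)).filter fun j => W j = 2 * ℓ - 1 ∧ W (j + 1) = 2 * ℓ).card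
        * (B * B * l2 y) := by
    intro ℓ hℓ
    rw [WPmat_mulVec u w X W hX hW hℓ]
    refine l2_sum_ite_le _ _ _ fun j hj => ?_
    rw [Finset.mem_range] at hj
    exact l2_smul_dot_le _ _ _ (hB _ (by omega)) (hB _ (by omega))
  have hc : ∀ ℓ : ℕ, ((Finset.range (T - 1)).filter
      fun j => W j = 2 * ℓ - 1 ∧ W (j + 1) = 2 * ℓ).card ≤ T := by
    intro ℓ
    refine (Finset.card_filter_le _ _).trans ?_
    simp
  by_cases h : ℓ = 1 ∧ i = 0
  · obtain ⟨rfl, rfl⟩ := h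
    simp only [WPfam, WPone, if_true, beq_self_eq_true, Matrix.add_mulVec]
    have hcount : ((Finset.range (T - 1)).filter
        fun j => W j = 2 * (1 : ℕ) - 1 ∧ W (j + 1) = 2 * (1 : ℕ)).card
        + ((Finset.range T).filter fun j => W j = 1).card ≤ T := by
      have e1 : ((Finset.range (T - 1)).filter
          fun j => W j = 2 * (1 : ℕ) - 1 ∧ W (j + 1) = 2 * (1 : ℕ)).card
          ≤ ((Finset.range T).filter fun j => ¬ W j = 1).card := by
        refine Finset.card_le_card_of_injOn (· + 1) ?_ (fun a _ b _ h => by simpa using h)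
        intro j hj
        simp only [Finset.coe_filter, Finset.mem_range, Set.mem_ofPred_eq] at hj ⊢
        refine ⟨by omega, by omega⟩
      have e2 := Finset.card_filter_add_card_filter_not (s := Finset.range T) (fun j => W j = 1)
      rw [Finset.card_range] at e2
      omega
    have h2 : l2 ((WPcorr u w).mulVec y)
        ≤ ((Finset.range T).filter fun j => W j = 1).card * (B * B * l2 y) := by
      rw [WPcorr_mulVec u w X W hX hW hT]
      split_ifs
      · have ho : l2 (oneSum X W T) ≤ ((Finset.range T).filter fun j => W j = 1).card * B := by
          rw [oneSum_eq_sum]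
          exact l2_sum_ite_le _ _ _ fun j hj => hB j (Finset.mem_range.mp hj)
        refine (l2_smul_dot_le y _ _ (hB _ (by omega)) ho).trans (le_of_eq ?_)
        ring
      · rw [l2_zero]
        positivity
    refine (l2_add_le _ _).trans ((add_le_add (h1 le_rfl) h2).trans ?_)
    rw [← add_mul]
    refine mul_le_mul_of_nonneg_right ?_ hC
    exact_mod_cast hcount
  · have e : WPfam u w i ℓ = WPmat u w ℓ := by
      unfold WPfam WPone
      split_ifs with h0 h2
      · exact absurd ⟨h0, by simpa using h2⟩ h
      · rw [add_zero, h0]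
      · rfl
    rw [e]
    refine (h1 hℓ).trans (mul_le_mul_of_nonneg_right ?_ hC)
    exact_mod_cast hc ℓ

lemma l2_vnetOut_le (hX : ∀ j (h : j < T), X j = u ⟨j, h⟩)
    (hW : ∀ j (h : j < T), W j = w ⟨j, h⟩) (hT : 0 < T) {B : ℝ} (hB : ∀ j < T, l2 (X j) ≤ B)
    (i : ℕ) {z : Fin d → ℝ} (hz : ∀ k, z k ∈ Set.Icc (0 : ℝ) 1) (ℓ : ℕ) :
    l2 (vnetOut d relu (WPfam u w i) z ℓ) ≤ Real.sqrt d * (T * B ^ 2) ^ ℓ := by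
  induction ℓ with
  | zero => simpa [vnetOut] using l2_le_sqrt hz
  | succ ℓ ih =>
    rw [vnetOut]
    refine (l2_WPfam_mulVec_le u w X W hX hW hT hB i (by omega) _).trans ?_
    have h : l2 (fun k => if ℓ = 0 then vnetOut d relu (WPfam u w i) z ℓ k
        else relu (vnetOut d relu (WPfam u w i) z ℓ k)) ≤ Real.sqrt d * (T * B ^ 2) ^ ℓ := by
      by_cases h0 : ℓ = 0
      · simpa only [if_pos h0] using ih
      · simp only [if_neg h0]
        exact (l2_relu_le _).trans ih
    calc _ ≤ T * (B * B * (Real.sqrt d * (T * B ^ 2) ^ ℓ)) := by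
          have := mul_self_nonneg B
          gcongr
      _ = _ := by ring

end Norms
end PromptTF


namespace PromptTF

section Identification

variable {d T : ℕ} (u : Fin T → Fin d → ℝ) (w : Fin T → ℕ) (X : ℕ → Fin d → ℝ) (W : ℕ → ℤ)
  (N v : ℕ)

lemma sum_idx_eq_zero (hN : 0 < N) (hw : ∀ j < T, 1 ≤ W j)
    (hW : ∀ k, T ≤ k → W k = -(((k - T) / N : ℕ) : ℤ)) :
    ∑ j ∈ Finset.range (T + N + v), (if W j = 0 then 1 else 0) = N := by
  rw [Finset.sum_range_add, Finset.sum_range_add]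
  have e1 : ∑ j ∈ Finset.range T, (if W j = 0 then 1 else 0) = 0 := by
    refine Finset.sum_eq_zero fun j hj => if_neg ?_
    have := hw j (Finset.mem_range.mp hj)
    omega
  have e2 : ∑ j ∈ Finset.range N, (if W (T + j) = 0 then 1 else 0) = N := by
    rw [Finset.sum_congr rfl (g := fun _ => 1)]
    · simp
    · intro j hj
      rw [hW _ (by omega), Nat.add_sub_cancel_left, Nat.div_eq_of_lt (Finset.mem_range.mp hj)]
      simp
  have e3 : ∑ j ∈ Finset.range v, (if W (T + N + j) = 0 then 1 else 0) = 0 := by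
    refine Finset.sum_eq_zero fun j hj => if_neg ?_
    rw [hW _ (by omega), add_assoc, Nat.add_sub_cancel_left, Nat.add_div_left _ hN]
    generalize j / N = q
    omega
  rw [e1, e2, e3]
  ring

lemma idx_nonpos (hW : ∀ k, T ≤ k → W k = -(((k - T) / N : ℕ) : ℤ)) {k : ℕ} (hk : T ≤ k) :
    W k ≤ 0 := by
  rw [hW k hk]
  exact neg_nonpos.mpr (Nat.cast_nonneg _)

lemma srcEmb_eq (hN : 0 < N) :
    srcEmb X (T + N + v) N (T + N + v - 1) = fun k => relu (X (T + v) k) := by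
  funext i
  rw [srcEmb, Finset.sum_eq_single (T + v), if_pos (by omega)]
  · intro j _ hj
    exact if_neg (by omega)
  · intro h
    exact absurd (Finset.mem_range.mpr (by omega)) h

lemma srcIdx_eq (hN : 0 < N) :
    srcIdx W (T + N + v) N (T + N + v - 1) = W (T + v) := by
  rw [srcIdx, Finset.sum_eq_single (T + v), if_pos (by omega)]
  · intro j _ hj
    exact if_neg (by omega)
  · intro h
    exact absurd (Finset.mem_range.mpr (by omega)) h

lemma oneSum_eq (hW : ∀ k, T ≤ k → W k = -(((k - T) / N : ℕ) : ℤ)) :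
    oneSum X W (T + N + v) = oneSum X W T := by
  funext i
  rw [oneSum, oneSum, add_assoc, Finset.sum_range_add, add_eq_left]
  refine Finset.sum_eq_zero fun j _ => if_neg ?_
  have := idx_nonpos W N hW (k := T + j) (by omega)
  omega

lemma outEmb_eq (hX : ∀ j (h : j < T), X j = u ⟨j, h⟩)
    (hWw : ∀ j (h : j < T), W j = w ⟨j, h⟩) (hT : 0 < T) (hN : 0 < N) (hw : ∀ j < T, 1 ≤ W j)
    (hW : ∀ k, T ≤ k → W k = -(((k - T) / N : ℕ) : ℤ)) :
    outEmb X W (T + N + v) N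
      = (WPfam u w (v % N) (v / N + 1)).mulVec fun k => relu (X (T + v) k) := by
  obtain ⟨q, hq⟩ : ∃ q, v / N = q := ⟨_, rfl⟩
  rw [hq]
  have hy := srcEmb_eq (T := T) X N v hN
  have hi := srcIdx_eq (T := T) W N v hN
  set y : Fin d → ℝ := fun k => relu (X (T + v) k) with hydef
  have hsrc : W (T + v) = -(q : ℤ) := by
    rw [hW _ (by omega), Nat.add_sub_cancel_left, hq]
  have hlast : W (T + N + v - 1) = 0 ↔ v = 0 := by
    rw [hW _ (by omega)]
    have : T + N + v - 1 - T = N + v - 1 := by omega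
    rw [this, neg_eq_zero, Nat.cast_eq_zero, Nat.div_eq_zero_iff]
    omega
  have hpos : ∀ j, 0 < W j → j < T := by
    intro j hj
    by_contra hc
    have := idx_nonpos W N hW (k := j) (by omega)
    omega
  have hWT : W T = 0 := by
    rw [hW T le_rfl]
    simp
  have hsplit : outEmb X W (T + N + v) N
      = (∑ j ∈ Finset.range (T + N + v),
          if nextIdx W (T + N + v) j = W j + 1 ∧ W j = 1 - 2 * W (T + v) then
            (∑ k, y k * nextEmb X (T + N + v) j k) • X j else 0)
        + ∑ j ∈ Finset.range (T + N + v),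
          if W j = 1 ∧ nextIdx W (T + N + v) j = 0 ∧ W (T + N + v - 1) = 0 then
            (∑ k, y k * oneSum X W T k) • X j else 0 := by
    funext i
    rw [Pi.add_apply, Finset.sum_apply, Finset.sum_apply, ← Finset.sum_add_distrib, outEmb]
    refine Finset.sum_congr rfl fun j _ => ?_
    rw [hi, hy, oneSum_eq X W N v hW]
    congr 1 <;> split_ifs <;> simp
  have hmain : (∑ j ∈ Finset.range (T + N + v),
      if nextIdx W (T + N + v) j = W j + 1 ∧ W j = 1 - 2 * W (T + v) then
        (∑ k, y k * nextEmb X (T + N + v) j k) • X j else 0)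
      = (WPmat u w (q + 1)).mulVec y := by
    rw [WPmat_mulVec u w X W hX hWw (by omega)]
    symm
    have hsub : Finset.range (T - 1) ⊆ Finset.range (T + N + v) := by
      intro j
      simp only [Finset.mem_range]
      omega
    rw [Finset.sum_subset hsub]
    · refine Finset.sum_congr rfl fun j hj => ?_
      rw [Finset.mem_range] at hj
      unfold nextIdx nextEmb
      by_cases h : j + 1 < T + N + v
      · simp only [if_pos h]
        congr 1
        rw [hsrc]
        push_cast
        apply propext
        constructor <;> rintro ⟨h1, h2⟩ <;> constructor <;> omega
      · have : ¬ W j = 2 * ((q + 1 : ℕ) : ℤ) - 1 := by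
          intro h0
          have := hpos j (by push_cast at h0; omega)
          omega
        rw [if_neg (fun h => this h.1), if_neg]
        rintro ⟨-, h0⟩
        refine this ?_
        rw [h0, hsrc]
        push_cast
        ring
    · intro j _ hj2
      refine if_neg ?_
      rintro ⟨-, h2⟩
      have := hpos (j + 1) (by rw [h2]; push_cast; positivity)
      rw [Finset.mem_range] at hj2
      omega
  rw [hsplit, hmain]
  by_cases hv : v = 0
  · have hcorr : (∑ j ∈ Finset.range (T + N + v),
        if W j = 1 ∧ nextIdx W (T + N + v) j = 0 ∧ W (T + N + v - 1) = 0 then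
          (∑ k, y k * oneSum X W T k) • X j else 0) = (WPcorr u w).mulVec y := by
      rw [WPcorr_mulVec u w X W hX hWw hT, Finset.sum_eq_single (T - 1)]
      · congr 1
        have h1 : T - 1 + 1 = T := by omega
        rw [nextIdx, h1, if_pos (by omega), hWT]
        simp only [hlast.mpr hv, and_true]
      · intro j _ hj
        refine if_neg ?_
        rintro ⟨h1, h2, -⟩
        have h3 := hpos j (by omega)
        rw [nextIdx, if_pos (by omega)] at h2
        have := hw (j + 1) (by omega)
        omega
      · intro h
        exact absurd (Finset.mem_range.mpr (by omega)) h
    rw [hcorr]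
    have hq0 : q = 0 := by rw [← hq, hv, Nat.zero_div]
    rw [hq0, hv]
    simp [WPfam, WPone, Matrix.add_mulVec]
  · have hcorr : (∑ j ∈ Finset.range (T + N + v),
        if W j = 1 ∧ nextIdx W (T + N + v) j = 0 ∧ W (T + N + v - 1) = 0 then
          (∑ k, y k * oneSum X W T k) • X j else 0) = 0 :=
      Finset.sum_eq_zero fun j _ => if_neg fun h => hv (hlast.mp h.2.2)
    have hfam : WPfam u w (v % N) (q + 1) = WPmat u w (q + 1) := by
      unfold WPfam WPone
      split_ifs with h1 h2
      · exfalso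
        refine hv ?_
        have h3 : v / N = 0 := by rw [hq]; omega
        have h4 : v % N = 0 := by simpa using h2
        have := Nat.div_add_mod v N
        rw [h3, h4] at this
        omega
      · rw [add_zero, h1]
      · rfl
    rw [hcorr, add_zero, hfam]

end Identification
end PromptTF

namespace PromptTF

section Generation

variable {d T N : ℕ} (hN : 0 < N) (u : Fin T → Fin d → ℝ) (w : Fin T → ℕ)
  (z : Fin N → Fin d → ℝ) (S : ℝ)

/-- The word embedding at position `k` of the emulated sequence. -/
def genEmb (k : ℕ) : Fin d → ℝ :=
  if h : k < T then u ⟨k, h⟩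
  else vnetOut d relu (WPfam u w ((k - T) % N)) (z ⟨(k - T) % N, Nat.mod_lt _ hN⟩) ((k - T) / N)

/-- The layer index at position `k` of the emulated sequence. -/
def genIdx (N : ℕ) {T : ℕ} (w : Fin T → ℕ) (k : ℕ) : ℤ :=
  if h : k < T then w ⟨k, h⟩ else -(((k - T) / N : ℕ) : ℤ)

lemma genEmb_of_lt (j : ℕ) (h : j < T) : genEmb hN u w z j = u ⟨j, h⟩ := dif_pos h

lemma genIdx_of_lt (j : ℕ) (h : j < T) : genIdx N w j = w ⟨j, h⟩ := dif_pos h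

lemma genIdx_of_le (k : ℕ) (h : T ≤ k) : genIdx N w k = -(((k - T) / N : ℕ) : ℤ) :=
  dif_neg h.not_gt

lemma genEmb_add (k : ℕ) : genEmb hN u w z (T + k)
    = vnetOut d relu (WPfam u w (k % N)) (z ⟨k % N, Nat.mod_lt _ hN⟩) (k / N) := by
  rw [genEmb, dif_neg (by omega)]
  simp only [Nat.add_sub_cancel_left]

lemma genEmb_add_mul (i : Fin N) (ℓ : ℕ) : genEmb hN u w z (T + (N * ℓ + i))
    = vnetOut d relu (WPfam u w i) (z i) ℓ := by
  rw [genEmb_add]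
  have h1 : (N * ℓ + i) % N = i := by rw [Nat.mul_add_mod, Nat.mod_eq_of_lt i.2]
  have h2 : (N * ℓ + i) / N = ℓ := by
    rw [Nat.mul_add_div hN, Nat.div_eq_of_lt i.2, add_zero]
  simp only [h1, h2]

/-- The token at zero-based position `k` of the emulated sequence. -/
def genTok (k : ℕ) : Fin (4 * d + 8) → ℝ :=
  promptToken d (genEmb hN u w z k) (genIdx N w k) (k + 1) S

lemma initialInput_eq :
    initialInput d T N u w S z = (List.range (T + N)).map (genTok hN u w z S) := by
  rw [List.range_add, List.map_append, List.map_map, initialInput,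
    ← List.map_coe_finRange_eq_range, ← List.map_coe_finRange_eq_range, List.map_map, List.map_map]
  congr 1
  · refine List.map_congr_left fun j _ => ?_
    rw [Function.comp_apply, genTok, genEmb_of_lt hN u w z j j.2, genIdx_of_lt w j j.2]
  · refine List.map_congr_left fun i _ => ?_
    have h := genEmb_add_mul hN u w z i 0
    rw [mul_zero, zero_add] at h
    simp only [Function.comp_apply]
    rw [genTok, h, genIdx_of_le w _ (by omega), Nat.add_sub_cancel_left, Nat.div_eq_of_lt i.2]
    rfl

lemma l2_genEmb_le {B : ℝ} (hB : 1 ≤ B) (hT : 0 < T) (hd : 0 < d) (hu : ∀ j, l2 (u j) ≤ B)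
    (hz : ∀ i k, z i k ∈ Set.Icc (0 : ℝ) 1) {L : ℕ} (hL : 0 < L) {k : ℕ}
    (hk : k < T + N * (L + 1)) :
    l2 (genEmb hN u w z k) ≤ Real.sqrt d * (T * B ^ 2) ^ L := by
  have hd1 : 1 ≤ Real.sqrt d := Real.one_le_sqrt.mpr (by exact_mod_cast hd)
  have hT1 : (1 : ℝ) ≤ T := by exact_mod_cast hT
  have hTB : B ≤ T * B ^ 2 := by nlinarith
  have h1 : 1 ≤ T * B ^ 2 := hB.trans hTB
  by_cases h : k < T
  · rw [genEmb_of_lt hN u w z k h]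
    calc l2 (u ⟨k, h⟩) ≤ B := hu _
      _ ≤ T * B ^ 2 := hTB
      _ ≤ (T * B ^ 2) ^ L := le_self_pow₀ h1 hL.ne'
      _ ≤ _ := le_mul_of_one_le_left (by positivity) hd1
  · obtain ⟨m, rfl⟩ : ∃ m, k = T + m := ⟨k - T, by omega⟩
    rw [genEmb_add]
    refine (l2_vnetOut_le u w (genEmb hN u w z) (genIdx N w) (genEmb_of_lt hN u w z)
      (genIdx_of_lt w) hT (B := B) (fun j hj => ?_) _ (hz _) _).trans ?_
    · rw [genEmb_of_lt hN u w z j hj]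
      exact hu _
    · have : m / N ≤ L := Nat.lt_succ_iff.mp (Nat.div_lt_of_lt_mul (by simpa using hk))
      gcongr

lemma l2_oneSum_le {B : ℝ} {X : ℕ → Fin d → ℝ} (W : ℕ → ℤ) (hX : ∀ j < T, l2 (X j) ≤ B)
    (hB : 0 ≤ B) : l2 (oneSum X W T) ≤ T * B := by
  rw [oneSum_eq_sum]
  refine (l2_sum_ite_le _ _ _ fun j hj => hX j (Finset.mem_range.mp hj)).trans ?_
  refine mul_le_mul_of_nonneg_right ?_ hB
  exact_mod_cast (Finset.card_filter_le _ _).trans (Finset.card_range T).le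

lemma genTok_step {B : ℝ} (hB : 1 ≤ B) (hT : 0 < T) (hd : 0 < d) (hu : ∀ j, l2 (u j) ≤ B)
    (hw : ∀ j, 1 ≤ w j) (hz : ∀ i k, z i k ∈ Set.Icc (0 : ℝ) 1) {L : ℕ} (hL : 0 < L)
    (hS : max ((d : ℝ) * B ^ (4 * L) * (T : ℝ) ^ (2 * L)) (2 * (L : ℝ)) ≤ S) {v : ℕ}
    (hv : v < N * L) :
    (tfForward (emulatorLayers.map fun θ => θ.layer d)
      ((List.range (T + N + v)).map (genTok hN u w z S))).getLastD (fun _ => 0)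
      = genTok hN u w z S (T + N + v) := by
  obtain ⟨hS1, hS2⟩ := max_le_iff.mp hS
  have hL1 : (1 : ℝ) ≤ L := by exact_mod_cast hL
  have hT1 : (1 : ℝ) ≤ T := by exact_mod_cast hT
  have hd1 : 1 ≤ Real.sqrt d := Real.one_le_sqrt.mpr (by exact_mod_cast hd)
  have hwz : ∀ j < T, 1 ≤ genIdx N w j := by
    intro j hj
    rw [genIdx_of_lt w j hj]
    exact_mod_cast hw _
  set R := Real.sqrt d * (T * B ^ 2) ^ L with hR
  have hRR : R * R ≤ S := by
    refine le_trans (le_of_eq ?_) hS1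
    have := Real.mul_self_sqrt (Nat.cast_nonneg (α := ℝ) d)
    calc R * R = (Real.sqrt d * Real.sqrt d) * ((T * B ^ 2) ^ L * (T * B ^ 2) ^ L) := by
          rw [hR]; ring
      _ = _ := by rw [this]; ring
  have hR0 : 0 ≤ R := by positivity
  have hNL : N * (L + 1) = N + N * L := by ring
  have hXR : ∀ k < T + N * (L + 1), l2 (genEmb hN u w z k) ≤ R := fun k hk =>
    l2_genEmb_le hN u w z hB hT hd hu hz hL hk
  have hy : l2 (fun k => relu (genEmb hN u w z (T + v) k)) ≤ R :=
    (l2_relu_le _).trans (hXR _ (by omega))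
  have hbound : ∀ x : Fin d → ℝ, l2 x ≤ R →
      |∑ k, relu (genEmb hN u w z (T + v) k) * x k| ≤ S := fun x hx =>
    (abs_dot_le _ _).trans ((mul_le_mul hy hx (l2_nonneg _) hR0).trans hRR)
  have hstep := getLastD_emulator (genEmb hN u w z) (genIdx N w) S (T + N + v) N (by omega)
    (by linarith) (sum_idx_eq_zero (genIdx N w) N v hN hwz (genIdx_of_le w))
    (by
      intro j hj
      rw [srcEmb_eq _ N v hN]
      refine hbound _ ?_
      unfold nextEmb
      split_ifs
      · exact hXR _ (by omega)
      · rw [l2_zero]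
        exact hR0)
    (by
      rw [srcEmb_eq _ N v hN, oneSum_eq _ _ N v (genIdx_of_le w)]
      refine hbound _ ((l2_oneSum_le (genIdx N w) (B := B) (fun j hj => ?_) (by linarith)).trans ?_)
      · rw [genEmb_of_lt hN u w z j hj]
        exact hu _
      · have hTB : T * B ≤ T * B ^ 2 :=
          mul_le_mul_of_nonneg_left (le_self_pow₀ hB two_ne_zero) (by positivity)
        have h1 : 1 ≤ T * B ^ 2 := one_le_mul_of_one_le_of_one_le hT1 (one_le_pow₀ hB)
        calc T * B ≤ T * B ^ 2 := hTB
          _ ≤ (T * B ^ 2) ^ L := le_self_pow₀ h1 hL.ne'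
          _ ≤ _ := le_mul_of_one_le_left (by positivity) hd1)
    (idx_nonpos _ N (genIdx_of_le w) (by omega))
  have hfun : genTok hN u w z S = fun k =>
    promptToken d (genEmb hN u w z k) (genIdx N w k) (k + 1) S := rfl
  rw [hfun, hstep, srcIdx_eq _ N v hN, outEmb_eq u w _ _ N v (genEmb_of_lt hN u w z)
    (genIdx_of_lt w) hT hN hwz (genIdx_of_le w)]
  have e1 : genIdx N w (T + v) - 1 = genIdx N w (T + N + v) := by
    rw [genIdx_of_le w _ (by omega), genIdx_of_le w _ (by omega), Nat.add_sub_cancel_left,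
      add_assoc, Nat.add_sub_cancel_left, Nat.add_div_left _ hN]
    push_cast
    ring
  have e2 : (WPfam u w (v % N) (v / N + 1)).mulVec (fun k => relu (genEmb hN u w z (T + v) k))
      = genEmb hN u w z (T + N + v) := by
    rw [add_assoc, genEmb_add, genEmb_add]
    simp only [Nat.add_mod_left, Nat.add_div_left _ hN, vnetOut]
    congr 1
    funext k
    split_ifs with h
    · rw [h]
      exact max_eq_left (hz _ _).1
    · rfl
  rw [e1, e2]

lemma genTokens_emulator {B : ℝ} (hB : 1 ≤ B) (hT : 0 < T) (hd : 0 < d) (hu : ∀ j, l2 (u j) ≤ B)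
    (hw : ∀ j, 1 ≤ w j) (hz : ∀ i k, z i k ∈ Set.Icc (0 : ℝ) 1) {L : ℕ} (hL : 0 < L)
    (hS : max ((d : ℝ) * B ^ (4 * L) * (T : ℝ) ^ (2 * L)) (2 * (L : ℝ)) ≤ S) {v : ℕ}
    (hv : v ≤ N * L) :
    genTokens (tfForward (emulatorLayers.map fun θ => θ.layer d)) (initialInput d T N u w S z) v
      = (List.range (T + N + v)).map (genTok hN u w z S) := by
  induction v with
  | zero => rw [genTokens, initialInput_eq hN, add_zero]
  | succ v ih =>
    rw [genTokens, ih (by omega), genTok_step hN u w z S hB hT hd hu hw hz hL hS (by omega),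
      ← add_assoc, List.range_succ, List.map_append]
    rfl

end Generation

/-- The emulator has the emulation property. -/
theorem emulatesWith_emulatorLayers {d : ℕ} (hd : 0 < d) :
    EmulatesWith d (tfForward (emulatorLayers.map fun θ => θ.layer d)) relu := by
  intro B hB T L hT hL U hU S hS u w hP N hN z hz i ℓ hℓ1 hℓL
  have hlen : (initialInput d T N u w S z).length = T + N := by simp [initialInput]
  obtain ⟨ℓ, rfl⟩ : ∃ m, ℓ = m + 1 := ⟨ℓ - 1, by omega⟩
  have hv : T + N * (ℓ + 1) + i + 1 - (T + N) = N * ℓ + i + 1 := by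
    rw [mul_add, mul_one]
    omega
  have hle : N * ℓ + i + 1 ≤ N * L := by
    have h1 : N * (ℓ + 1) ≤ N * L := Nat.mul_le_mul_left N hℓL
    have h2 := i.2
    rw [mul_add, mul_one] at h1
    omega
  have hlt : T + N * (ℓ + 1) + i < T + N + (N * ℓ + i + 1) := by
    rw [mul_add, mul_one]
    omega
  rw [tokenAt, hlen, hv, genTokens_emulator hN u w z S hB hT hd (fun j => hU (hP.1 j))
    (fun j => (hP.2 j).1) hz hL hS hle, Nat.add_sub_cancel,
    List.getD_eq_getElem _ _ (by simpa using hlt), List.getElem_map,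
    List.getElem_range, genTok, add_assoc T, genEmb_add_mul,
    genIdx_of_le w _ (by omega), Nat.add_sub_cancel_left, Nat.mul_add_div hN,
    Nat.div_eq_of_lt i.2, add_zero]

lemma emulatorLayers_heads_le : ∀ θ ∈ emulatorLayers, θ.M ≤ 8 := by
  have h (M : ℕ) (hM : M ≤ 8) (hs : Fin M → HeadSpec) {p q : ℕ} (W1 : Pattern p q 4 8)
      (W2 : Pattern 4 8 p q) : (Blueprint.ofHeads hs W1 W2).M ≤ 8 := hM
  intro θ hθ
  simp only [emulatorLayers, List.mem_cons, List.not_mem_nil, or_false] at hθ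
  rcases hθ with rfl | rfl | rfl | rfl | rfl | rfl | rfl
  · exact h 6 (by norm_num) ..
  · exact h 6 (by norm_num) ..
  · exact h 6 (by norm_num) ..
  all_goals exact h 0 (by norm_num) ..

end PromptTF

/-- There is a universal constant `c > 0` such that for every `d ∈ ℕ+` there
are `7`-layer transformer parameters `Θ*` with token dimension `4d+8`, at most `8` attention
heads per layer, FFN width at most `c·d`, at most `c·d` nonzero parameter entries in total,
all entries bounded by `c` in absolute value, which have the emulation property. -/
theorem statement_3 :
    ∃ c : ℕ, 0 < c ∧
      ∀ d : ℕ, 0 < d →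
        ∃ Θ : List (TFLayer (4 * d + 8)),
          Θ.length = 7 ∧
          (∀ θ ∈ Θ, θ.M ≤ 8) ∧
          (∀ θ ∈ Θ, θ.width ≤ c * d) ∧
          tfNonzero Θ ≤ c * d ∧
          (∀ θ ∈ Θ, layerEntriesBounded θ (c : ℝ)) ∧
          EmulatesWith d (tfForward Θ) relu := by
  obtain ⟨c, hc, h⟩ := exists_bound_of_blueprints emulatorLayers
  refine ⟨c, hc, fun d hd => ?_⟩
  obtain ⟨hwidth, hnonzero, hbound⟩ := h d hd
  have hemu := emulatesWith_emulatorLayers hd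
  have hlen : (emulatorLayers.map fun θ => θ.layer d).length = 7 := by
    rw [List.length_map]
    rfl
  have hheads : ∀ θ ∈ emulatorLayers.map fun θ => θ.layer d, θ.M ≤ 8 := by
    intro θ hθ
    obtain ⟨θ', hθ', rfl⟩ := List.mem_map.mp hθ
    exact emulatorLayers_heads_le θ' hθ'
  have hentries := hbound c le_rfl
  generalize (emulatorLayers.map fun θ => θ.layer d) = Θ at *
  exact ⟨Θ, hlen, hheads, hwidth, hnonzero, hentries, hemu⟩
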